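/- arXiv:0907.1172 — 10 statements merged into one kernel-verified Lean document; each statement's English description precedes it below -/
import Mathlib

section
/- Let S be a commutative *-semigroup with a neutral element 0 and let u ∈ S satisfy σ(u+u) = 1 and σ(u) = σ(u*) for every character σ on S. Then the set {[s] ∈ S/∼ : [u+s] ≠ [s]} is finite if and only if the set {σ ∈ S* : σ(u) = -1} is finite. -/
open scoped ComplexOrder

/-- `σ : S → ℂ` is a character on the commutative `*`-semigroup `(S, add, st)`:
it is not identically zero, multiplicative and `*`-preserving. -/
def IsChar {S : Type*} (add : S → S → S) (st : S → S) (σ : S → ℂ) : Prop :=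
  (∃ s, σ s ≠ 0) ∧ (∀ a b, σ (add a b) = σ a * σ b) ∧
    (∀ a, σ (st a) = starRingEnd ℂ (σ a))

/-- The relation `s ∼ t` iff `σ s = σ t` for all characters `σ`. -/
def charEquiv {S : Type*} (add : S → S → S) (st : S → S) : Setoid S where
  r a b := ∀ σ : S → ℂ, IsChar add st σ → σ a = σ b
  iseqv := ⟨fun _ _ _ => rfl, fun h σ hσ => (h σ hσ).symm,
    fun h1 h2 σ hσ => (h1 σ hσ).trans (h2 σ hσ)⟩

/-- Addition on the greatest `*`-separative `*`-homomorphic image `S/∼`. -/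
def qAdd {S : Type*} (add : S → S → S) (st : S → S) :
    Quotient (charEquiv add st) → Quotient (charEquiv add st) → Quotient (charEquiv add st) :=
  Quotient.map₂ add (by
    intro a b hab c d hcd σ hσ
    rw [hσ.2.1, hσ.2.1, hab σ hσ, hcd σ hσ])

/-- Involution on `S/∼`. -/
def qStar {S : Type*} (add : S → S → S) (st : S → S) :
    Quotient (charEquiv add st) → Quotient (charEquiv add st) :=
  Quotient.map st (by
    intro a b hab σ hσ
    rw [hσ.2.2, hσ.2.2, hab σ hσ])

theorem IsChar.ne_zero_of_neutral {S : Type*} {add : S → S → S} {st : S → S} {σ : S → ℂ}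
    (hσ : IsChar add st σ) {z : S} (hz : ∀ s, add z s = s) : σ z ≠ 0 := by
  obtain ⟨s, hs⟩ := hσ.1
  intro h
  apply hs
  rw [← hz s, hσ.2.1, h, zero_mul]

theorem IsChar.mul {S : Type*} {add : S → S → S} {st : S → S} {σ τ : S → ℂ}
    (hσ : IsChar add st σ) (hτ : IsChar add st τ) {z : S} (hz : ∀ s, add z s = s) :
    IsChar add st (σ * τ) := by
  refine ⟨⟨z, mul_ne_zero (hσ.ne_zero_of_neutral hz) (hτ.ne_zero_of_neutral hz)⟩, ?_, ?_⟩
  · intro a b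
    simp only [Pi.mul_apply, hσ.2.1, hτ.2.1]
    ring
  · intro a
    simp only [Pi.mul_apply, hσ.2.2, hτ.2.2, map_mul]

theorem IsChar.pow_succ {S : Type*} {add : S → S → S} {st : S → S} {σ : S → ℂ}
    (hσ : IsChar add st σ) {z : S} (hz : ∀ s, add z s = s) (n : ℕ) :
    IsChar add st (σ ^ (n + 1)) := by
  induction n with
  | zero => simpa using hσ
  | succ n ih => rw [_root_.pow_succ]; exact ih.mul hσ hz

theorem finite_setOf_pow_eq_pow {i j : ℕ} (hij : i ≠ j) : {x : ℂ | x ^ i = x ^ j}.Finite := by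
  have hp : (Polynomial.X ^ i - Polynomial.X ^ j : Polynomial ℂ) ≠ 0 := by
    intro h
    have := congrArg (fun p => p.coeff i) h
    simp [Polynomial.coeff_X_pow, hij] at this
  refine (Polynomial.finite_setOfPred_isRoot hp).subset fun x hx => ?_
  simpa [Polynomial.IsRoot, sub_eq_zero] using hx

theorem exists_char_eq_pow_succ {S : Type*} (add : S → S → S) (st : S → S) (s : S) :
    ∃ p : ℕ → S, ∀ σ : S → ℂ, IsChar add st σ → ∀ n, σ (p n) = σ s ^ (n + 1) := by
  refine ⟨fun n => Nat.rec s (fun _ t => add t s) n, fun σ hσ n => ?_⟩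
  induction n with
  | zero => simp
  | succ n ih => rw [_root_.pow_succ, ← ih]; exact hσ.2.1 _ _

/-- A class is moved by `u` iff some character with value `-1` at `u` does not vanish on it. -/
theorem qAdd_mk_ne_iff {S : Type*} {add : S → S → S} {st : S → S} {u : S}
    (hu : ∀ σ : S → ℂ, IsChar add st σ → σ (add u u) = 1) (s : S) :
    qAdd add st (Quotient.mk (charEquiv add st) u) (Quotient.mk (charEquiv add st) s) ≠
        Quotient.mk (charEquiv add st) s ↔
      ∃ σ : S → ℂ, (IsChar add st σ ∧ σ u = -1) ∧ σ s ≠ 0 := by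
  have h : qAdd add st (Quotient.mk (charEquiv add st) u) (Quotient.mk (charEquiv add st) s) =
      Quotient.mk (charEquiv add st) s ↔ ∀ σ : S → ℂ, IsChar add st σ → σ (add u s) = σ s :=
    Quotient.eq (r := charEquiv add st)
  rw [Ne, h]
  push Not
  constructor
  · rintro ⟨σ, hσ, hne⟩
    rw [hσ.2.1] at hne
    have h1 := hu σ hσ
    rw [hσ.2.1, mul_self_eq_one_iff] at h1
    rcases h1 with h1 | h1
    · simp [h1] at hne
    · exact ⟨σ, ⟨hσ, h1⟩, fun h0 => hne (by simp [h0])⟩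
  · rintro ⟨σ, ⟨hσ, h1⟩, hne⟩
    refine ⟨σ, hσ, ?_⟩
    rw [hσ.2.1, h1, neg_one_mul]
    exact fun h => hne (neg_eq_self.mp h)

/-- Let `S` be a commutative `*`-semigroup with a neutral element `0` and let `u ∈ S`
satisfy `σ(u+u) = 1` and `σ(u) = σ(u*)` for every character `σ` on `S`.  Then the set
`{[s] ∈ S/∼ : [u+s] ≠ [s]}` is finite iff the set `{σ ∈ S* : σ(u) = -1}` is finite. -/
theorem stmt0 {S : Type*} (add : S → S → S) (st : S → S)
    (hcomm : ∀ a b, add a b = add b a)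
    (hassoc : ∀ a b c, add (add a b) c = add a (add b c))
    (hstadd : ∀ a b, st (add a b) = add (st a) (st b))
    (hstinv : ∀ a, st (st a) = a)
    (z : S) (hz : ∀ s, add z s = s)
    (u : S)
    (hu : ∀ σ : S → ℂ, IsChar add st σ → σ (add u u) = 1 ∧ σ u = σ (st u)) :
    {c : Quotient (charEquiv add st) |
        qAdd add st (Quotient.mk (charEquiv add st) u) c ≠ c}.Finite ↔
      {σ : S → ℂ | IsChar add st σ ∧ σ u = -1}.Finite := by
  have hu1 : ∀ σ : S → ℂ, IsChar add st σ → σ (add u u) = 1 := fun σ hσ => (hu σ hσ).1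
  constructor
  · intro hfin
    have key : ∀ s, {x : ℂ | ∃ σ : S → ℂ, (IsChar add st σ ∧ σ u = -1) ∧ σ s = x}.Finite := by
      intro s
      obtain ⟨p, hp⟩ := exists_char_eq_pow_succ add st s
      by_cases hall : ∀ n, ∃ σ : S → ℂ, (IsChar add st σ ∧ σ u = -1) ∧ σ (p n) ≠ 0
      · obtain ⟨i, -, j, -, hij, he⟩ := Set.infinite_univ.exists_ne_map_eq_of_mapsTo
          (f := fun n => Quotient.mk (charEquiv add st) (p n))
          (fun n _ => (qAdd_mk_ne_iff hu1 (p n)).mpr (hall n)) hfin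
        have he' : ∀ σ : S → ℂ, IsChar add st σ → σ (p i) = σ (p j) :=
          (Quotient.eq (r := charEquiv add st)).mp he
        refine (finite_setOf_pow_eq_pow (i := i + 1) (j := j + 1) (by omega)).subset ?_
        rintro _ ⟨σ, ⟨hσ, -⟩, rfl⟩
        simpa only [Set.mem_ofPred_eq, hp σ hσ] using he' σ hσ
      · push Not at hall
        obtain ⟨n, hn⟩ := hall
        refine (Set.finite_singleton (0 : ℂ)).subset ?_
        rintro _ ⟨σ, hσ, rfl⟩
        have h0 := hn σ hσ
        rw [hp σ hσ.1] at h0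
        exact pow_eq_zero_iff (Nat.succ_ne_zero n) |>.mp h0
    have := hfin.to_subtype
    have hpi := Set.Finite.pi' (fun c : {c : Quotient (charEquiv add st) |
        qAdd add st (Quotient.mk (charEquiv add st) u) c ≠ c} => key c.1.out)
    refine Set.Finite.of_injOn (f := fun σ c => σ c.1.out) ?_ ?_ hpi
    · exact fun σ hσ c => ⟨σ, hσ, rfl⟩
    · intro σ hσ τ hτ h
      have hout : ∀ ρ : S → ℂ, IsChar add st ρ → ∀ s,
          ρ (Quotient.mk (charEquiv add st) s).out = ρ s := fun ρ hρ s =>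
        (Quotient.mk_out (s := charEquiv add st) s) ρ hρ
      funext s
      by_cases hs : ∃ σ : S → ℂ, (IsChar add st σ ∧ σ u = -1) ∧ σ s ≠ 0
      · have := congrFun h ⟨Quotient.mk (charEquiv add st) s, (qAdd_mk_ne_iff hu1 s).mpr hs⟩
        simpa only [hout σ hσ.1, hout τ hτ.1] using this
      · push Not at hs
        rw [hs σ hσ, hs τ hτ]
  · intro hfin
    have key : ∀ σ : S → ℂ, IsChar add st σ ∧ σ u = -1 → (Set.range σ).Finite := by
      intro σ hσ
      obtain ⟨i, -, j, -, hij, he⟩ := Set.infinite_univ.exists_ne_map_eq_of_mapsTo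
        (f := fun n : ℕ => σ ^ (2 * n + 1))
        (fun n _ => show IsChar add st (σ ^ (2 * n + 1)) ∧ (σ ^ (2 * n + 1)) u = -1 from
          ⟨hσ.1.pow_succ hz (2 * n), by simp [hσ.2, _root_.pow_succ, pow_mul]⟩) hfin
      refine (finite_setOf_pow_eq_pow (i := 2 * i + 1) (j := 2 * j + 1) (by omega)).subset ?_
      rintro _ ⟨s, rfl⟩
      exact congrFun he s
    have := hfin.to_subtype
    have hpi := Set.Finite.pi' (fun σ : {σ : S → ℂ | IsChar add st σ ∧ σ u = -1} =>
      key σ.1 σ.2)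
    refine Set.Finite.of_injOn (f := fun c σ => σ.1 c.out) ?_ ?_ hpi
    · exact fun c _ σ => ⟨c.out, rfl⟩
    · intro c hc d _ h
      rw [← Quotient.out_eq c, Set.mem_ofPred_eq] at hc
      obtain ⟨σ, hσ, hne⟩ := (qAdd_mk_ne_iff hu1 c.out).mp hc
      have hagree : ∀ ρ : S → ℂ, IsChar add st ρ → ρ u = -1 → ρ c.out = ρ d.out :=
        fun ρ hρ hρu => congrFun h ⟨ρ, hρ, hρu⟩
      rw [← Quotient.out_eq c, ← Quotient.out_eq d]
      refine Quotient.sound (s := charEquiv add st) fun τ hτ => ?_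
      have h1 := hu1 τ hτ
      rw [hτ.2.1, mul_self_eq_one_iff] at h1
      rcases h1 with h1 | h1
      · have h2 := hagree (σ * τ) (hσ.1.mul hτ hz) (by simp [hσ.2, h1])
        simp only [Pi.mul_apply] at h2
        rw [← hagree σ hσ.1 hσ.2] at h2
        exact mul_left_cancel₀ hne h2
      · exact hagree τ hτ h1
end

section
/- Let S be a commutative *-semigroup with a neutral element 0 and let u ∈ S satisfy σ(u+u) = 1 and σ(u) = σ(u*) for every character σ on S. Then σ(u) = -1 for only finitely many characters σ on S if and only if for every positive definite function φ : S → ℂ the function s ↦ φ(s+u) has a finite number of negative squares. -/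
open scoped ComplexOrder

/-- `φ : S → ℂ` is positive definite on the commutative `*`-semigroup `(S, add, st)`. -/
def IsPosDefFn {S : Type*} (add : S → S → S) (st : S → S) (φ : S → ℂ) : Prop :=
  ∀ (n : ℕ) (s : Fin n → S) (ξ : Fin n → ℂ),
    0 ≤ ∑ i, ∑ j, ξ i * starRingEnd ℂ (ξ j) * φ (add (st (s j)) (s i))

/-- number of negative eigenvalues (with multiplicities) of a Hermitian matrix. -/
noncomputable def negEigCount {n : ℕ} {A : Matrix (Fin n) (Fin n) ℂ}
    (hA : A.IsHermitian) : ℕ :=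
  (Finset.univ.filter fun i => hA.eigenvalues i < 0).card

/-- The number of negative squares of `ψ` is at most `k`: every Hermitian matrix
`(ψ (sᵢ + sⱼ*))ᵢⱼ` has at most `k` negative eigenvalues, counted with multiplicities. -/
def NegSquaresLE {S : Type*} (add : S → S → S) (st : S → S) (ψ : S → ℂ) (k : ℕ) : Prop :=
  ∀ (n : ℕ) (s : Fin n → S)
    (h : (Matrix.of fun i j : Fin n => ψ (add (s i) (st (s j)))).IsHermitian),
    negEigCount h ≤ k

/-- `ψ` has a finite number of negative squares. -/
def HasFinNegSquares {S : Type*} (add : S → S → S) (st : S → S) (ψ : S → ℂ) : Prop :=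
  ∃ k, NegSquaresLE add st ψ k

/-- `π` is formally real with respect to the involution `J`: a vanishing sum of hermitian squares
has vanishing terms. -/
def FormallyReal {R B : Type*} [CommRing R] [CommRing B] (J : R →+* R) (π : R →+* B) : Prop :=
  ∀ (n : ℕ) (f : ℕ → R), π (∑ i ∈ Finset.range n, J (f i) * f i) = 0 → ∀ i < n, π (f i) = 0

namespace FormallyReal

variable {R B : Type*} [CommRing R] [CommRing B] {J : R →+* R} {π : R →+* B}

lemma eq_zero_of_conj_mul_self (H : FormallyReal J π) {f : R} (hf : π (J f * f) = 0) :
    π f = 0 :=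
  H 1 (fun _ => f) (by simpa using hf) 0 one_pos

lemma isReduced (H : FormallyReal J π) (hJ : ∀ f, J (J f) = f) (hπ : Function.Surjective π) :
    IsReduced B := by
  refine (isReduced_iff_pow_one_lt 2 one_lt_two).2 fun x hx => ?_
  obtain ⟨f, rfl⟩ := hπ x
  apply H.eq_zero_of_conj_mul_self
  apply H.eq_zero_of_conj_mul_self
  have : J (J f * f) * (J f * f) = (J f) ^ 2 * f ^ 2 := by rw [map_mul, hJ]; ring
  rw [this, map_mul, map_pow π f, hx, mul_zero]

/-- If positive elements `x * J x` and `y * J y` have the same `m`-th power up to multiplication by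
a nonnegative element `a` dominating both, they agree after multiplication by `a`. -/
lemma mul_eq_of_pow_mul_eq (H : FormallyReal J π) (hJ : ∀ f, J (J f) = f)
    (hπ : Function.Surjective π) {x y a : R} (ha : J a = a) {m : ℕ} (hm : 0 < m)
    (h : π (((x * J x) ^ m - (y * J y) ^ m) * a) = 0) :
    π ((x * J x - y * J y) * a) = 0 := by
  have := H.isReduced hJ hπ
  set w := (x * J x - y * J y) * a with hw
  have hJw : J w = w := by simp only [hw, map_mul, map_sub, hJ, ha]; ring
  have key : ∀ i < m, π (x ^ i * y ^ (m - 1 - i) * w) = 0 := by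
    apply H m
    have : ∑ i ∈ Finset.range m, J (x ^ i * y ^ (m - 1 - i) * w) * (x ^ i * y ^ (m - 1 - i) * w)
        = (((x * J x) ^ m - (y * J y) ^ m) * a) * w := by
      rw [← (Commute.all (x * J x) (y * J y)).geom_sum₂_mul, mul_assoc _ _ a, ← hw, mul_assoc,
        Finset.sum_mul]
      refine Finset.sum_congr rfl fun i _ => ?_
      rw [map_mul, hJw, map_mul, map_pow, map_pow]
      ring
    rw [this, map_mul, h, zero_mul]
  have hkill : ∀ v : R, π (v ^ (m - 1) * w) = 0 → π v * π w = 0 := by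
    intro v hv
    apply eq_zero_of_pow_eq_zero (n := m)
    obtain ⟨k, rfl⟩ : ∃ k, m = k + 1 := ⟨m - 1, by omega⟩
    simp only [Nat.add_sub_cancel, map_mul, map_pow] at hv
    calc (π v * π w) ^ (k + 1) = (π v ^ k * π w) * (π v * π w ^ k) := by ring
      _ = 0 := by rw [hv, zero_mul]
  have hx : π x * π w = 0 := hkill x (by simpa using key (m - 1) (by omega))
  have hy : π y * π w = 0 := hkill y (by simpa using key 0 hm)
  apply eq_zero_of_pow_eq_zero (n := 2)
  calc π w ^ 2 = (π x * π w) * (π (J x) * π a) - (π y * π w) * (π (J y) * π a) := by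
        rw [sq]; nth_rewrite 1 [hw]; simp only [map_mul, map_sub]; ring
    _ = 0 := by rw [hx, hy]; ring

/-- Cancellation in the archimedean component of `s`. -/
lemma eq_of_relations (H : FormallyReal J π) (hJ : ∀ f, J (J f) = f)
    (hπ : Function.Surjective π) {s t x y z : R} {m : ℕ} (hm : 0 < m)
    (h₁ : s * (y * J y) * z = t * (x * J x) * z) (h₂ : s ^ m * z = t ^ m * z)
    (hs : ∃ n, s ∣ (t * J t) ^ n) (ht : ∃ n, t ∣ (s * J s) ^ n)
    (hy : ∃ n, y ∣ (s * J s) ^ n) (hz : ∃ n, z ∣ (s * J s) ^ n) :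
    π s = π t := by
  have := H.isReduced hJ hπ
  set A := s * J s with hA
  have hJA : J A = A := by rw [hA, map_mul, hJ]; ring
  have hJdvd : ∀ {v : R} {n : ℕ}, v ∣ A ^ n → J v ∣ A ^ n := fun {v n} ⟨c, hc⟩ =>
    ⟨J c, by rw [← map_mul, ← hc, map_pow, hJA]⟩
  obtain ⟨nt, ht⟩ := ht
  obtain ⟨ny, hy⟩ := hy
  obtain ⟨nz, hz⟩ := hz
  obtain ⟨ns, c, hc⟩ := hs
  have cancel : ∀ {v d : R} {n : ℕ}, d ∣ A ^ n → π (v * d) = 0 → π (v * A) = 0 := by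
    rintro v d n ⟨e, he⟩ h
    apply eq_zero_of_pow_eq_zero (n := n + 1)
    calc π (v * A) ^ (n + 1) = π (v * A ^ n) * π (v ^ n * A) := by
          rw [← map_pow, ← map_mul]; congr 1; ring
      _ = 0 := by rw [he, ← mul_assoc, map_mul _ (v * d), h, zero_mul, zero_mul]
  have hXY : π ((x * J x - y * J y) * A) = 0 := by
    refine H.mul_eq_of_pow_mul_eq hJ hπ hJA hm ?_
    have hd : t ^ m * z ^ m ∣ A ^ (nt * m + nz * m) := by
      rw [pow_add, pow_mul, pow_mul]
      exact mul_dvd_mul (pow_dvd_pow_of_dvd ht m) (pow_dvd_pow_of_dvd hz m)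
    refine cancel hd ?_
    have h₁' : s ^ m * (y * J y) ^ m * z ^ m = t ^ m * (x * J x) ^ m * z ^ m := by
      rw [← mul_pow, ← mul_pow, h₁]; ring
    have h₂' : s ^ m * z ^ m = t ^ m * z ^ m := by
      obtain ⟨k, rfl⟩ : ∃ k, m = k + 1 := ⟨m - 1, by omega⟩
      rw [pow_succ z, mul_comm (z ^ k), ← mul_assoc, h₂]; ring
    rw [← map_zero π]
    congr 1
    linear_combination (y * J y) ^ m * h₂' - h₁'
  have hst : π ((s - t) * A) = 0 := by
    have hd : (y * J y) * z * A ∣ A ^ (ny + ny + nz + 1) := by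
      rw [pow_add, pow_add, pow_add, pow_one]
      exact mul_dvd_mul (mul_dvd_mul (mul_dvd_mul hy (hJdvd hy)) hz) dvd_rfl
    refine cancel hd ?_
    have : (s - t) * (y * J y * z * A) = ((x * J x - y * J y) * A) * (t * z) := by
      linear_combination A * h₁
    rw [this, map_mul, hXY, zero_mul]
  have hsts : π ((s - t) * s) = 0 := by
    apply H.eq_zero_of_conj_mul_self
    have : J ((s - t) * s) * ((s - t) * s) = ((s - t) * A) * J (s - t) := by
      rw [map_mul, hA]; ring
    rw [this, map_mul, hst, zero_mul]
  have hstt : π ((s - t) * t) = 0 := by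
    have hT : π ((s - t) * (t * J t)) = 0 := by
      apply eq_zero_of_pow_eq_zero (n := ns + 1)
      calc π ((s - t) * (t * J t)) ^ (ns + 1)
          = π ((s - t) * (t * J t) ^ ns) * π ((s - t) ^ ns * (t * J t)) := by
            rw [← map_pow, ← map_mul]; congr 1; generalize s - t = p; ring
        _ = 0 := by rw [hc, ← mul_assoc, map_mul _ ((s - t) * s), hsts, zero_mul, zero_mul]
    apply H.eq_zero_of_conj_mul_self
    have : J ((s - t) * t) * ((s - t) * t) = ((s - t) * (t * J t)) * J (s - t) := by
      rw [map_mul]; ring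
    rw [this, map_mul, hT, zero_mul]
  rw [← sub_eq_zero, ← map_sub]
  apply eq_zero_of_pow_eq_zero (n := 2)
  rw [← map_pow, show (s - t) ^ 2 = (s - t) * s - (s - t) * t by ring, map_sub, hsts, hstt,
    sub_zero]

end FormallyReal

lemma exists_addMonoidHom_real_ne_zero {Q : Type*} [AddCommGroup Q] {q : Q}
    (hq : ∀ m : ℕ, 0 < m → m • q ≠ 0) : ∃ ρ : Q →+ ℝ, ρ q ≠ 0 := by
  have hinj : Function.Injective (zmultiplesHom Q q) := by
    rw [injective_iff_map_eq_zero]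
    intro a ha
    by_contra h
    simp only [zmultiplesHom_apply] at ha
    refine hq a.natAbs (Int.natAbs_pos.2 h) ?_
    rw [← natCast_zsmul]
    rcases Int.natAbs_eq a with h' | h'
    · rw [← h', ha]
    · rw [← neg_eq_zero, ← neg_zsmul, ← h', ha]
  obtain ⟨ρ, hρ⟩ := (Module.Baer.of_divisible ℝ).extension_property_addMonoidHom _ hinj
    (zmultiplesHom ℝ 1)
  refine ⟨ρ, ?_⟩
  have := DFunLike.congr_fun hρ 1
  simp at this
  simp [this]

lemma exists_monoidHom_circle_ne_one {Q : Type*} [CommGroup Q] {q : Q} (hq : q ≠ 1) :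
    ∃ χ : Q →* Circle, χ q ≠ 1 := by
  obtain ⟨c, hc⟩ := CharacterModule.exists_character_apply_ne_zero_of_ne_zero
    (A := Additive Q) (a := Additive.ofMul q) (by simpa using hq)
  let c' : Additive Q →+ AddCircle (1 : ℚ) := c
  let e : AddCircle (1 : ℚ) →+ AddCircle (1 : ℝ) :=
    QuotientAddGroup.map _ _ (Rat.castHom ℝ).toAddMonoidHom (by
      rintro _ ⟨n, rfl⟩
      exact ⟨n, by simp⟩)
  have he : Function.Injective e := by
    rw [injective_iff_map_eq_zero]
    intro a ha
    induction a using QuotientAddGroup.induction_on with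
    | H r =>
      have h1 : ((r : ℝ) : AddCircle (1 : ℝ)) = 0 := ha
      rw [AddCircle.coe_eq_zero_iff] at h1
      obtain ⟨n, hn⟩ := h1
      refine (AddCircle.coe_eq_zero_iff _).2 ⟨n, ?_⟩
      simp only [zsmul_eq_mul, mul_one] at hn ⊢
      exact_mod_cast hn
  refine ⟨{ toFun := fun g => (e (c' (Additive.ofMul g))).toCircle
            map_one' := by simp
            map_mul' := fun a b => by simp [AddCircle.toCircle_add] }, ?_⟩
  intro h
  have h' : (e (c' (Additive.ofMul q))).toCircle = AddCircle.toCircle (0 : AddCircle (1 : ℝ)) := by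
    rw [AddCircle.toCircle_zero]; exact h
  have := AddCircle.injective_toCircle one_ne_zero h'
  rw [← map_zero e] at this
  exact hc (he this)

lemma IsPosDefFn.sum_nonneg {S : Type*} {add : S → S → S} {st : S → S} {φ : S → ℂ}
    (hφ : IsPosDefFn add st φ) {ι : Type*} [Fintype ι] (s : ι → S) (ξ : ι → ℂ) :
    0 ≤ ∑ i, ∑ j, ξ i * starRingEnd ℂ (ξ j) * φ (add (st (s j)) (s i)) := by
  let e := (Fintype.equivFin ι).symm
  convert hφ _ (s ∘ e) (ξ ∘ e) using 1
  rw [← Equiv.sum_comp e]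
  refine Finset.sum_congr rfl fun i _ => ?_
  rw [← Equiv.sum_comp e]
  rfl

lemma eq_zero_of_forall_nonneg {p a b : ℂ}
    (h : ∀ c : ℂ, 0 ≤ p + c * a + starRingEnd ℂ c * b) : a = 0 := by
  have h0 := h 0
  simp only [Complex.le_def, Complex.zero_re, Complex.zero_im] at h h0
  simp at h0
  have key : ∀ c : ℂ, c * a + starRingEnd ℂ c * b = 0 := by
    intro c
    have him : (c * a + starRingEnd ℂ c * b).im = 0 := by
      have := (h c).2
      simp only [Complex.add_im] at this ⊢
      linarith [h0.2]
    have hre : (c * a + starRingEnd ℂ c * b).re = 0 := by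
      by_contra hne
      set r := (c * a + starRingEnd ℂ c * b).re with hr
      have hs := (h ((-(p.re + 1) / r : ℝ) * c)).1
      have : p + ((-(p.re + 1) / r : ℝ) : ℂ) * c * a
          + starRingEnd ℂ (((-(p.re + 1) / r : ℝ) : ℂ) * c) * b
          = p + ((-(p.re + 1) / r : ℝ) : ℂ) * (c * a + starRingEnd ℂ c * b) := by
        rw [map_mul, Complex.conj_ofReal]; ring
      rw [this, Complex.add_re, Complex.re_ofReal_mul, ← hr, div_mul_cancel₀ _ hne] at hs
      linarith
    exact Complex.ext hre him
  have h1 := key 1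
  have h2 := key Complex.I
  simp only [map_one, Complex.conj_I] at h1 h2
  have h3 : Complex.I * (a - b) = 0 := by linear_combination h2
  have h4 : a - b = 0 := by simpa using h3
  linear_combination (1 / 2 : ℂ) * h1 + (1 / 2 : ℂ) * h4

section MonoidAlgebra

variable {M : Type*} [CommMonoid M] [StarMul M]

/-- The conjugate linear involution of the monoid algebra extending `star`. -/
noncomputable def algConj (M : Type*) [CommMonoid M] [StarMul M] :
    MonoidAlgebra ℂ M →+* MonoidAlgebra ℂ M :=
  (MonoidAlgebra.mapRingHom M (starRingEnd ℂ)).comp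
    (MonoidAlgebra.mapDomainRingHom ℂ (starMulAut : MulAut M).toMonoidHom)

lemma algConj_single (m : M) (c : ℂ) :
    algConj M (MonoidAlgebra.single m c) = MonoidAlgebra.single (star m) (starRingEnd ℂ c) := by
  simp [algConj]

lemma algConj_algConj (f : MonoidAlgebra ℂ M) : algConj M (algConj M f) = f := by
  have : (algConj M).comp (algConj M) = RingHom.id _ := by
    refine MonoidAlgebra.ringHom_ext (fun c => ?_) fun m => ?_ <;> simp [algConj_single]
  exact DFunLike.congr_fun this f

/-- The linear functional on the monoid algebra with values `φ` on the monoid. -/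
noncomputable def algFunctional (φ : M → ℂ) : MonoidAlgebra ℂ M →ₗ[ℂ] ℂ :=
  Finsupp.linearCombination ℂ φ ∘ₗ (MonoidAlgebra.coeffLinearEquiv ℂ).toLinearMap

omit [CommMonoid M] [StarMul M] in
lemma algFunctional_single (φ : M → ℂ) (m : M) (c : ℂ) :
    algFunctional φ (MonoidAlgebra.single m c) = c * φ m := by
  simp [algFunctional]

lemma algFunctional_conj_mul_self_nonneg {φ : M → ℂ} (hφ : IsPosDefFn (· * ·) star φ)
    (f : MonoidAlgebra ℂ M) : 0 ≤ algFunctional φ (algConj M f * f) := by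
  have hf : f = ∑ i : f.coeff.support, MonoidAlgebra.single (i : M) (f.coeff i) := by
    rw [Finset.sum_coe_sort f.coeff.support fun i => MonoidAlgebra.single i (f.coeff i)]
    exact f.sum_coeff_single.symm
  convert hφ.sum_nonneg (fun i : f.coeff.support => (i : M)) fun i => f.coeff i using 1
  rw [congrArg (fun g => algFunctional φ (algConj M g * g)) hf]
  rw [map_sum, Finset.sum_mul_sum, map_sum, Finset.sum_comm]
  simp only [map_sum, algConj_single, MonoidAlgebra.single_mul_single, algFunctional_single]
  simp only [mul_comm]

/-- The ideal of elements orthogonal to everything with respect to the functional given by `φ`. -/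
def nullIdeal (φ : M → ℂ) : Ideal (MonoidAlgebra ℂ M) where
  carrier := {f | ∀ g, algFunctional φ (g * f) = 0}
  zero_mem' g := by simp
  add_mem' {a b} ha hb g := by rw [mul_add, map_add, ha g, hb g, add_zero]
  smul_mem' c f hf g := by rw [smul_eq_mul, ← mul_assoc, hf]

lemma mem_nullIdeal_of_conj_mul_self {φ : M → ℂ} (hφ : IsPosDefFn (· * ·) star φ)
    {f : MonoidAlgebra ℂ M} (hf : algFunctional φ (algConj M f * f) = 0) : f ∈ nullIdeal φ := by
  intro g
  refine eq_zero_of_forall_nonneg (p := algFunctional φ (g * algConj M g))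
    (b := algFunctional φ (algConj M f * algConj M g)) fun c => ?_
  convert algFunctional_conj_mul_self_nonneg hφ (algConj M g + c • f) using 1
  have : algConj M (c • f) = starRingEnd ℂ c • algConj M f := by
    have hc (d : ℂ) (h : MonoidAlgebra ℂ M) : d • h = MonoidAlgebra.single 1 d * h := by
      rw [← mul_one d, ← smul_eq_mul, ← MonoidAlgebra.smul_single, smul_mul_assoc, smul_eq_mul,
        mul_one, ← MonoidAlgebra.one_def, one_mul]
    rw [hc, map_mul, algConj_single, star_one, hc]
  rw [map_add, algConj_algConj, this]
  simp only [add_mul, mul_add, map_add, smul_mul_assoc, mul_smul_comm, map_smul, smul_eq_mul, hf,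
    mul_zero, add_zero]
  ring

lemma formallyReal_mk_nullIdeal {φ : M → ℂ} (hφ : IsPosDefFn (· * ·) star φ) :
    FormallyReal (algConj M) (Ideal.Quotient.mk (nullIdeal φ)) := by
  intro n f hf i hi
  rw [Ideal.Quotient.eq_zero_iff_mem] at hf ⊢
  apply mem_nullIdeal_of_conj_mul_self hφ
  have h1 := hf 1
  rw [one_mul, map_sum, Finset.sum_eq_zero_iff_of_nonneg fun i _ =>
    algFunctional_conj_mul_self_nonneg hφ (f i)] at h1
  exact h1 i (Finset.mem_range.2 hi)

end MonoidAlgebra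

section Characters

variable {M : Type*} [CommMonoid M] [StarMul M]

/-- The `star`-preserving monoid homomorphisms into `ℂ`, as a submonoid under pointwise
multiplication. -/
def starCharacters (M : Type*) [CommMonoid M] [StarMul M] : Submonoid (M →* ℂ) where
  carrier := {σ | ∀ x, σ (star x) = starRingEnd ℂ (σ x)}
  one_mem' x := by simp
  mul_mem' {σ τ} hσ hτ x := by simp [hσ x, hτ x]

/-- The face generated by `s`: all divisors of powers of `s * star s`. -/
def starFace (s : M) : Submonoid M where
  carrier := {x | ∃ n, x ∣ (s * star s) ^ n}
  one_mem' := ⟨0, one_dvd _⟩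
  mul_mem' := by
    rintro a b ⟨m, hm⟩ ⟨n, hn⟩
    exact ⟨m + n, by rw [pow_add]; exact mul_dvd_mul hm hn⟩

lemma self_mem_starFace (s : M) : s ∈ starFace s := ⟨1, by rw [pow_one]; exact dvd_mul_right _ _⟩

lemma mul_mem_starFace_iff {s x y : M} :
    x * y ∈ starFace s ↔ x ∈ starFace s ∧ y ∈ starFace s := by
  refine ⟨?_, fun h => mul_mem h.1 h.2⟩
  rintro ⟨n, hn⟩
  exact ⟨⟨n, (dvd_mul_right x y).trans hn⟩, ⟨n, (dvd_mul_left y x).trans hn⟩⟩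

lemma star_mem_starFace {s x : M} (hx : x ∈ starFace s) : star x ∈ starFace s := by
  obtain ⟨n, c, hc⟩ := hx
  refine ⟨n, star c, ?_⟩
  rw [← star_mul', ← hc, star_pow, star_mul', star_star, mul_comm s]

lemma star_mem_starFace_iff {s x : M} : star x ∈ starFace s ↔ x ∈ starFace s :=
  ⟨fun h => star_star x ▸ star_mem_starFace h, star_mem_starFace⟩

/-- The restriction of `star` to a face. -/
def starFaceStar (s : M) : starFace s →* starFace s where
  toFun x := ⟨star x, star_mem_starFace x.2⟩
  map_one' := Subtype.ext (star_one M)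
  map_mul' _ _ := Subtype.ext (star_mul' _ _)

/-- A character of a face extends by zero to a character of the whole semigroup. -/
lemma exists_starCharacter_extending {s : M} (f : starFace s →* ℂ)
    (hf : ∀ x, f (starFaceStar s x) = starRingEnd ℂ (f x)) :
    ∃ σ ∈ starCharacters M, (∀ x : starFace s, σ x = f x) ∧ ∀ x, x ∉ starFace s → σ x = 0 := by
  classical
  refine ⟨{ toFun := fun x => if h : x ∈ starFace s then f ⟨x, h⟩ else 0
            map_one' := by
              rw [dif_pos (one_mem _)]
              exact map_one f
            map_mul' := fun x y => ?_ }, fun x => ?_, fun x => ?_, fun x hx => ?_⟩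
  · by_cases hx : x ∈ starFace s
    · by_cases hy : y ∈ starFace s
      · rw [dif_pos (mul_mem hx hy), dif_pos hx, dif_pos hy, ← map_mul]
        rfl
      · rw [dif_neg fun h => hy (mul_mem_starFace_iff.1 h).2, dif_neg hy, mul_zero]
    · rw [dif_neg fun h => hx (mul_mem_starFace_iff.1 h).1, dif_neg hx, zero_mul]
  · by_cases hx : x ∈ starFace s
    · simp only [MonoidHom.coe_mk, OneHom.coe_mk, dif_pos hx, dif_pos (star_mem_starFace hx)]
      exact hf ⟨x, hx⟩
    · simp [hx, star_mem_starFace_iff]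
  · simp
  · simp [hx]

lemma mem_starFace_of_forall_eq {s t : M} (h : ∀ σ ∈ starCharacters M, σ s = σ t) :
    t ∈ starFace s := by
  obtain ⟨σ, hσ, hσ₁, hσ₀⟩ := exists_starCharacter_extending (1 : starFace s →* ℂ) (by simp)
  by_contra ht
  have h₁ := h σ hσ
  rw [hσ₀ t ht, show σ s = 1 from hσ₁ ⟨s, self_mem_starFace s⟩] at h₁
  exact one_ne_zero h₁

open Algebra

/-- The involution induced by `star` on the Grothendieck group of a face. -/
noncomputable def faceGroupStar (s : M) :
    GrothendieckGroup (starFace s) →* GrothendieckGroup (starFace s) :=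
  GrothendieckGroup.lift (GrothendieckGroup.of.comp (starFaceStar s))

lemma faceGroupStar_of (s : M) (x : starFace s) :
    faceGroupStar s (GrothendieckGroup.of x) = GrothendieckGroup.of (starFaceStar s x) :=
  DFunLike.congr_fun (GrothendieckGroup.lift.symm_apply_apply
    (GrothendieckGroup.of.comp (starFaceStar s))) x

lemma exists_eq_of_div_of {N : Type*} [CommMonoid N] (g : GrothendieckGroup N) :
    ∃ x y : N, g = GrothendieckGroup.of x / GrothendieckGroup.of y := by
  obtain ⟨⟨x, y⟩, h⟩ := (Localization.monoidOf (⊤ : Submonoid N)).surj g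
  exact ⟨x, y, eq_div_of_mul_eq' h⟩

lemma exists_mul_eq_mul_of_of_eq {N : Type*} [CommMonoid N] {x y : N}
    (h : GrothendieckGroup.of x = GrothendieckGroup.of y) : ∃ z : N, x * z = y * z := by
  obtain ⟨z, hz⟩ := (Localization.monoidOf (⊤ : Submonoid N)).eq_iff_exists.1 h
  exact ⟨z, by rw [mul_comm x, mul_comm y]; exact hz⟩

lemma faceGroupStar_faceGroupStar (s : M) (g : GrothendieckGroup (starFace s)) :
    faceGroupStar s (faceGroupStar s g) = g := by
  obtain ⟨x, y, rfl⟩ := exists_eq_of_div_of g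
  have (x : starFace s) : starFaceStar s (starFaceStar s x) = x := Subtype.ext (star_star _)
  simp only [map_div, faceGroupStar_of, this]

/-- If no character separates `s` from `t`, then `s / t` is a hermitian square in the face group. -/
lemma exists_div_eq_mul_faceGroupStar {s t : M} (h : ∀ σ ∈ starCharacters M, σ s = σ t)
    (ht : t ∈ starFace s) :
    ∃ g, GrothendieckGroup.of ⟨s, self_mem_starFace s⟩ / GrothendieckGroup.of ⟨t, ht⟩
      = g * faceGroupStar s g := by
  set γ := GrothendieckGroup.of (⟨s, self_mem_starFace s⟩ : starFace s) /
    GrothendieckGroup.of ⟨t, ht⟩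
  set N := (MonoidHom.id _ * faceGroupStar s).range
  by_contra! hne
  have hγ : (γ : GrothendieckGroup (starFace s) ⧸ N) ≠ 1 := by
    rw [Ne, QuotientGroup.eq_one_iff]
    rintro ⟨g, hg⟩
    exact hne g hg.symm
  obtain ⟨χ, hχ⟩ := exists_monoidHom_circle_ne_one hγ
  let F : GrothendieckGroup (starFace s) →* Circle := χ.comp (QuotientGroup.mk' N)
  have hF : ∀ g, F (faceGroupStar s g) = (F g)⁻¹ := fun g => by
    rw [eq_inv_iff_mul_eq_one, mul_comm, ← map_mul]
    have : ((g * faceGroupStar s g : GrothendieckGroup (starFace s)) :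
        GrothendieckGroup (starFace s) ⧸ N) = 1 := (QuotientGroup.eq_one_iff _).2 ⟨g, rfl⟩
    change χ _ = 1
    rw [QuotientGroup.mk'_apply, this, map_one]
  obtain ⟨σ, hσ, hσF, -⟩ := exists_starCharacter_extending
    (Circle.coeHom.comp (F.comp GrothendieckGroup.of)) fun x => by
      change ((F (GrothendieckGroup.of (starFaceStar s x)) : Circle) : ℂ) = _
      rw [← faceGroupStar_of, hF, Circle.coe_inv_eq_conj]
      rfl
  have hst := h σ hσ
  rw [show σ s = _ from hσF ⟨s, self_mem_starFace s⟩, show σ t = _ from hσF ⟨t, ht⟩] at hst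
  apply hχ
  change F γ = 1
  rw [map_div, div_eq_one]
  exact Circle.ext hst

/-- If no character separates `s` from `t`, then some power of `s / t` is antihermitian in the face
group. -/
lemma exists_div_pow_eq_div_faceGroupStar {s t : M} (h : ∀ σ ∈ starCharacters M, σ s = σ t)
    (ht : t ∈ starFace s) :
    ∃ m, 0 < m ∧ ∃ g, (GrothendieckGroup.of (⟨s, self_mem_starFace s⟩ : starFace s) /
      GrothendieckGroup.of ⟨t, ht⟩) ^ m = g / faceGroupStar s g := by
  set γ := GrothendieckGroup.of (⟨s, self_mem_starFace s⟩ : starFace s) /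
    GrothendieckGroup.of ⟨t, ht⟩
  set N := (MonoidHom.id _ / faceGroupStar s).range
  by_contra! hne
  have hγ : ∀ m : ℕ, 0 < m →
      m • Additive.ofMul (γ : GrothendieckGroup (starFace s) ⧸ N) ≠ 0 := by
    intro m hm h0
    have : ((γ ^ m : GrothendieckGroup (starFace s)) : GrothendieckGroup (starFace s) ⧸ N) = 1 := h0
    rw [QuotientGroup.eq_one_iff] at this
    obtain ⟨g, hg⟩ := this
    exact hne m hm g hg.symm
  obtain ⟨ρ, hρ⟩ := exists_addMonoidHom_real_ne_zero hγ
  let F : GrothendieckGroup (starFace s) → ℝ := fun g => ρ (Additive.ofMul (QuotientGroup.mk' N g))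
  have hF : ∀ g, F (faceGroupStar s g) = F g := fun g => by
    simp only [F]
    congr 2
    symm
    rw [QuotientGroup.mk'_apply, QuotientGroup.mk'_apply, ← div_eq_one]
    exact (QuotientGroup.eq_one_iff _).2 ⟨g, rfl⟩
  have hFmul : ∀ a b, F (a * b) = F a + F b := fun a b => by simp [F]
  have hF1 : F 1 = 0 := by simp [F]
  let f : starFace s →* ℂ :=
    { toFun := fun x => (Real.exp (F (GrothendieckGroup.of x)) : ℝ)
      map_one' := by simp [hF1]
      map_mul' := fun a b => by rw [map_mul, hFmul, Real.exp_add, Complex.ofReal_mul] }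
  obtain ⟨σ, hσ, hσF, -⟩ := exists_starCharacter_extending f fun x => by
      change ((Real.exp (F (GrothendieckGroup.of (starFaceStar s x))) : ℝ) : ℂ) = _
      rw [← faceGroupStar_of, hF]
      exact (Complex.conj_ofReal _).symm
  have hst := h σ hσ
  rw [show σ s = _ from hσF ⟨s, self_mem_starFace s⟩, show σ t = _ from hσF ⟨t, ht⟩] at hst
  have hst' := Real.exp_injective (Complex.ofReal_injective hst)
  apply hρ
  change F γ = 0
  have := hFmul γ (GrothendieckGroup.of ⟨t, ht⟩)
  rw [div_mul_cancel, hst'] at this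
  linarith

/-- If no character separates `s` from `t`, then `s` and `t` are related in the archimedean
component of `s` in a way no positive definite function can distinguish. -/
lemma exists_relations {s t : M} (h : ∀ σ ∈ starCharacters M, σ s = σ t) :
    ∃ x y z : M, ∃ m, 0 < m ∧ y ∈ starFace s ∧ z ∈ starFace s ∧
      s * (y * star y) * z = t * (x * star x) * z ∧ s ^ m * z = t ^ m * z := by
  have ht := mem_starFace_of_forall_eq h
  obtain ⟨g, hg⟩ := exists_div_eq_mul_faceGroupStar h ht
  obtain ⟨m, hm, k, hk⟩ := exists_div_pow_eq_div_faceGroupStar h ht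
  set s' : starFace s := ⟨s, self_mem_starFace s⟩
  set t' : starFace s := ⟨t, ht⟩
  have hinv : faceGroupStar s (GrothendieckGroup.of s' / GrothendieckGroup.of t') =
      GrothendieckGroup.of s' / GrothendieckGroup.of t' := by
    rw [hg, map_mul, faceGroupStar_faceGroupStar, mul_comm]
  have htors : (GrothendieckGroup.of s' / GrothendieckGroup.of t') ^ (m + m) = 1 := by
    rw [pow_add, hk]
    nth_rewrite 1 [← hk]
    rw [← hinv, ← map_pow, hk, map_div, faceGroupStar_faceGroupStar]
    simp
  obtain ⟨x, y, rfl⟩ := exists_eq_of_div_of g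
  have h₁ : GrothendieckGroup.of (s' * (y * starFaceStar s y)) =
      GrothendieckGroup.of (t' * (x * starFaceStar s x)) := by
    simp only [map_div, faceGroupStar_of] at hg
    simp only [map_mul]
    rw [div_mul_div_comm, div_eq_div_iff_mul_eq_mul] at hg
    rw [hg, mul_comm]
  have h₂ : GrothendieckGroup.of (s' ^ (m + m)) = GrothendieckGroup.of (t' ^ (m + m)) := by
    rw [div_pow, div_eq_one] at htors
    simpa only [map_pow] using htors
  obtain ⟨z₁, hz₁⟩ := exists_mul_eq_mul_of_of_eq h₁
  obtain ⟨z₂, hz₂⟩ := exists_mul_eq_mul_of_of_eq h₂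
  refine ⟨x, y, z₁ * z₂, m + m, by omega, y.2, mul_mem z₁.2 z₂.2, ?_, ?_⟩
  · have : s * (y * star (y : M)) * z₁ * z₂ = t * (x * star (x : M)) * z₁ * z₂ :=
      congrArg (fun a : starFace s => (a : M) * z₂) hz₁
    simpa only [mul_assoc] using this
  · have := congrArg (fun a : starFace s => (a : M) * z₁) hz₂
    rw [mul_comm (z₁ : M), ← mul_assoc, ← mul_assoc]
    exact this

/-- Characters separate at least as well as positive definite functions. -/
lemma IsPosDefFn.eq_of_forall_starCharacters_eq {φ : M → ℂ} (hφ : IsPosDefFn (· * ·) star φ)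
    {s t : M} (h : ∀ σ ∈ starCharacters M, σ s = σ t) : φ s = φ t := by
  obtain ⟨x, y, z, m, hm, hy, hz, h₁, h₂⟩ := exists_relations h
  have ht := mem_starFace_of_forall_eq h
  have hs := mem_starFace_of_forall_eq fun σ hσ => (h σ hσ).symm
  let e : M →* MonoidAlgebra ℂ M := MonoidAlgebra.of ℂ M
  have he : ∀ v, algConj M (e v) = e (star v) := fun v => by
    simp [e, MonoidAlgebra.of_apply, algConj_single]
  have hdvd : ∀ {v w : M}, v ∈ starFace w → ∃ n, e v ∣ (e w * algConj M (e w)) ^ n := by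
    rintro v w ⟨n, hn⟩
    refine ⟨n, ?_⟩
    rw [he, ← map_mul, ← map_pow]
    exact map_dvd e hn
  have key := (formallyReal_mk_nullIdeal hφ).eq_of_relations algConj_algConj
    Ideal.Quotient.mk_surjective (s := e s) (t := e t) (x := e x) (y := e y) (z := e z) hm
    (by simp only [he, ← map_mul, h₁]) (by simp only [← map_mul, ← map_pow, h₂])
    (hdvd hs) (hdvd ht) (hdvd hy) (hdvd hz)
  rw [Ideal.Quotient.eq] at key
  have := key 1
  rwa [one_mul, map_sub, MonoidAlgebra.of_apply, MonoidAlgebra.of_apply, algFunctional_single,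
    algFunctional_single, one_mul, one_mul, sub_eq_zero] at this

/-- A linear relation between point evaluations satisfied by all characters is satisfied by all
positive definite functions. -/
lemma IsPosDefFn.linearCombination_eq_zero {φ : M → ℂ} (hφ : IsPosDefFn (· * ·) star φ)
    (c : M →₀ ℂ) (hc : ∀ σ ∈ starCharacters M, Finsupp.linearCombination ℂ σ c = 0) :
    Finsupp.linearCombination ℂ φ c = 0 := by
  let ev : M → starCharacters M →* ℂ := fun s => (MonoidHom.eval s).comp (starCharacters M).subtype
  have hfac : Function.FactorsThrough φ ev := fun s t hst =>
    hφ.eq_of_forall_starCharacters_eq fun σ hσ => DFunLike.congr_fun hst ⟨σ, hσ⟩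
  have h0 : Finsupp.mapDomain ev c = 0 := by
    apply linearIndependent_iff.1 (linearIndependent_monoidHom (starCharacters M) ℂ)
    rw [Finsupp.linearCombination_mapDomain]
    ext σ
    rw [Pi.zero_apply, ← hc σ σ.2, Finsupp.linearCombination_apply, Finsupp.linearCombination_apply,
      Finsupp.sum, Finsupp.sum, Finset.sum_apply]
    rfl
  have hφ' : φ = Function.extend ev φ 0 ∘ ev := by
    ext s
    exact (hfac.extend_apply 0 s).symm
  rw [hφ', ← Finsupp.linearCombination_mapDomain, h0, map_zero]

end Characters

section NegativeEigenvalues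

open Matrix

variable {n : ℕ} {A : Matrix (Fin n) (Fin n) ℂ}

lemma re_dotProduct_eigenvectorUnitary_mulVec (hA : A.IsHermitian) (y : Fin n → ℂ) :
    (star ((hA.eigenvectorUnitary : Matrix _ _ ℂ) *ᵥ y) ⬝ᵥ
      (A *ᵥ ((hA.eigenvectorUnitary : Matrix _ _ ℂ) *ᵥ y))).re =
      ∑ i, hA.eigenvalues i * ‖y i‖ ^ 2 := by
  have hAU := hA.conjStarAlgAut_star_eigenvectorUnitary
  rw [Unitary.conjStarAlgAut_star_apply] at hAU
  rw [star_mulVec, ← dotProduct_mulVec, mulVec_mulVec, mulVec_mulVec, ← star_eq_conjTranspose,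
    hAU, dotProduct, Complex.re_sum]
  refine Finset.sum_congr rfl fun i _ => ?_
  rw [mulVec_diagonal, Function.comp_apply, Pi.star_apply, mul_left_comm, Complex.star_def,
    ← Complex.normSq_eq_conj_mul_self]
  change ((hA.eigenvalues i : ℂ) * (Complex.normSq (y i) : ℂ)).re = _
  rw [Complex.re_ofReal_mul, Complex.ofReal_re, Complex.normSq_eq_norm_sq]

/-- A hermitian form which is nonnegative on the kernel of `T` has at most as many negative
eigenvalues as the dimension of the target of `T`. -/
lemma negEigCount_le_finrank (hA : A.IsHermitian) {V : Type*} [AddCommGroup V] [Module ℂ V]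
    [FiniteDimensional ℂ V] (T : (Fin n → ℂ) →ₗ[ℂ] V)
    (hT : ∀ x, T x = 0 → 0 ≤ (star x ⬝ᵥ (A *ᵥ x)).re) :
    negEigCount hA ≤ Module.finrank ℂ V := by
  by_contra! hlt
  let P : Fin n → Prop := fun i => hA.eigenvalues i < 0
  let Ψ : (Fin n → ℂ) →ₗ[ℂ] V × ({i // ¬ P i} → ℂ) :=
    (T ∘ₗ (hA.eigenvectorUnitary : Matrix _ _ ℂ).mulVecLin).prod (LinearMap.funLeft ℂ ℂ (↑))
  have hdim : Module.finrank ℂ (V × ({i // ¬ P i} → ℂ)) < Module.finrank ℂ (Fin n → ℂ) := by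
    rw [Module.finrank_prod, Module.finrank_fintype_fun_eq_card,
      Module.finrank_fintype_fun_eq_card, Fintype.card_subtype_compl, Fintype.card_fin]
    have h1 : Fintype.card {i // P i} = negEigCount hA := by
      rw [Fintype.card_subtype]; rfl
    have h2 : Fintype.card {i // P i} ≤ n := by
      simpa using Fintype.card_subtype_le P
    omega
  obtain ⟨y, hy, hy0⟩ := (Submodule.ne_bot_iff _).1
    (LinearMap.ker_ne_bot_of_finrank_lt (f := Ψ) hdim)
  have hΨ : Ψ y = 0 := hy
  have hTy : T ((hA.eigenvectorUnitary : Matrix _ _ ℂ) *ᵥ y) = 0 := congrArg Prod.fst hΨ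
  have hPy : ∀ i, ¬ P i → y i = 0 := fun i hi => congrFun (congrArg Prod.snd hΨ) ⟨i, hi⟩
  have hpos := hT _ hTy
  rw [re_dotProduct_eigenvectorUnitary_mulVec] at hpos
  obtain ⟨j, hj⟩ := Function.ne_iff.1 hy0
  have hPj : hA.eigenvalues j < 0 := by
    by_contra h
    exact hj (hPy j h)
  refine absurd hpos (not_le.2 (Finset.sum_neg' (fun i _ => ?_) ⟨j, Finset.mem_univ j, ?_⟩))
  · by_cases h : P i
    · exact mul_nonpos_of_nonpos_of_nonneg (le_of_lt h) (by positivity)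
    · simp [hPy i h]
  · exact mul_neg_of_neg_of_pos hPj (pow_pos (norm_pos_iff.2 hj) 2)

lemma negEigCount_eq_of_negDef (hA : A.IsHermitian)
    (h : ∀ x ≠ 0, (star x ⬝ᵥ (A *ᵥ x)).re < 0) : negEigCount hA = n := by
  rw [negEigCount, Finset.filter_true_of_mem, Finset.card_univ, Fintype.card_fin]
  intro i _
  rw [hA.eigenvalues_eq]
  refine h _ fun h0 => ?_
  have := hA.eigenvectorBasis.orthonormal.ne_zero i
  exact this (by ext j; exact congrFun h0 j)

lemma star_dotProduct_mulVec_eq_sum (x : Fin n → ℂ) :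
    star x ⬝ᵥ (A *ᵥ x) = ∑ i, ∑ j, starRingEnd ℂ (x i) * x j * A i j := by
  simp only [dotProduct, mulVec, Finset.mul_sum]
  refine Finset.sum_congr rfl fun i _ => Finset.sum_congr rfl fun j _ => ?_
  rw [Pi.star_apply, Complex.star_def]
  ring

end NegativeEigenvalues

section Main

open Matrix

variable {M : Type*} [CommMonoid M] [StarMul M]

lemma hasFinNegSquares_of_finite {u : M} (hu : ∀ σ ∈ starCharacters M, σ (u * u) = 1)
    (hfin : {σ : M →* ℂ | σ ∈ starCharacters M ∧ σ u = -1}.Finite) {φ : M → ℂ}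
    (hφ : IsPosDefFn (· * ·) star φ) :
    HasFinNegSquares (· * ·) star (fun s => φ (s * u)) := by
  refine ⟨Module.finrank ℂ (hfin.toFinset → ℂ), fun n s hA => ?_⟩
  let T : (Fin n → ℂ) →ₗ[ℂ] hfin.toFinset → ℂ :=
    LinearMap.pi fun σ => Fintype.linearCombination ℂ fun j => (σ : M →* ℂ) (star (s j))
  refine negEigCount_le_finrank hA T fun x hx => ?_
  have hrow : ∀ i, ∑ j, x j * φ (s i * star (s j) * u) = ∑ j, x j * φ (s i * star (s j)) := by
    intro i
    have key := hφ.linearCombination_eq_zero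
      (∑ j, (Finsupp.single (s i * star (s j) * u) (x j) - Finsupp.single (s i * star (s j)) (x j)))
      fun σ hσ => by
        simp only [map_sum, map_sub, Finsupp.linearCombination_single, smul_eq_mul, map_mul]
        have hσu : (σ u - 1) * (σ u + 1) = 0 := by
          have := hu σ hσ
          rw [map_mul] at this
          linear_combination this
        have hfactor : ∑ j, (x j * (σ (s i) * σ (star (s j)) * σ u) -
            x j * (σ (s i) * σ (star (s j)))) =
            (σ u - 1) * σ (s i) * ∑ j, x j * σ (star (s j)) := by
          rw [Finset.mul_sum]
          exact Finset.sum_congr rfl fun j _ => by ring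
        rw [hfactor]
        rcases mul_eq_zero.1 hσu with h | h
        · rw [h, zero_mul, zero_mul]
        · have h0 : ∑ j, x j * σ (star (s j)) = 0 :=
            congrFun hx ⟨σ, hfin.mem_toFinset.2 ⟨hσ, eq_neg_of_add_eq_zero_left h⟩⟩
          rw [h0, mul_zero]
    simp only [map_sum, map_sub, Finsupp.linearCombination_single, smul_eq_mul,
      Finset.sum_sub_distrib] at key
    exact sub_eq_zero.1 key
  have hform : star x ⬝ᵥ (Matrix.of (fun i j : Fin n => φ (s i * star (s j) * u)) *ᵥ x) =
      ∑ i, ∑ j, starRingEnd ℂ (x i) * starRingEnd ℂ (starRingEnd ℂ (x j)) *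
        φ (star (s j) * s i) := by
    rw [star_dotProduct_mulVec_eq_sum]
    refine Finset.sum_congr rfl fun i _ => ?_
    simp only [Matrix.of_apply, mul_assoc (starRingEnd ℂ (x i)), ← Finset.mul_sum, hrow,
      Complex.conj_conj, mul_comm (star _)]
  have := hφ n s fun i => starRingEnd ℂ (x i)
  rw [← hform] at this
  exact (Complex.le_def.1 this).1

/-- Raising the absolute value of a character to the power `1 + a`. -/
noncomputable def normRpowTwist (σ : M →* ℂ) (a : ℝ) : M →* ℂ where
  toFun x := σ x * ((‖σ x‖ ^ a : ℝ) : ℂ)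
  map_one' := by simp
  map_mul' x y := by
    rw [map_mul, norm_mul, Real.mul_rpow (norm_nonneg _) (norm_nonneg _), Complex.ofReal_mul]
    ring

omit [StarMul M] in
lemma norm_normRpowTwist (σ : M →* ℂ) (a : ℝ) (x : M) :
    ‖normRpowTwist σ a x‖ = ‖σ x‖ * ‖σ x‖ ^ a := by
  change ‖σ x * ((‖σ x‖ ^ a : ℝ) : ℂ)‖ = _
  rw [norm_mul, Complex.norm_real, Real.norm_of_nonneg (by positivity)]

lemma normRpowTwist_mem {σ : M →* ℂ} (hσ : σ ∈ starCharacters M) (a : ℝ) :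
    normRpowTwist σ a ∈ starCharacters M := by
  intro x
  change σ (star x) * ((‖σ (star x)‖ ^ a : ℝ) : ℂ) = starRingEnd ℂ (σ x * ((‖σ x‖ ^ a : ℝ) : ℂ))
  rw [hσ x, RCLike.norm_conj, map_mul, Complex.conj_ofReal]

lemma exists_bounded_sequence {u : M}
    (hinf : {σ : M →* ℂ | σ ∈ starCharacters M ∧ σ u = -1}.Infinite) :
    ∃ τ : ℕ → M →* ℂ, Function.Injective τ ∧ (∀ k, τ k ∈ starCharacters M ∧ τ k u = -1) ∧
      ∀ s, ∃ C, ∀ k, ‖τ k s‖ ≤ C := by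
  by_cases hbdd : ∀ σ ∈ starCharacters M, σ u = -1 → ∀ s, ‖σ s‖ ≤ 1
  · let e := hinf.natEmbedding
    exact ⟨fun k => e k, fun a b h => e.injective (Subtype.ext h), fun k => (e k).2,
      fun s => ⟨1, fun k => hbdd _ (e k).2.1 (e k).2.2 s⟩⟩
  · push Not at hbdd
    obtain ⟨σ, hσ, hσu, s, hs⟩ := hbdd
    refine ⟨fun k => normRpowTwist σ (1 / ((k : ℝ) + 1)), fun a b h => ?_, fun k =>
      ⟨normRpowTwist_mem hσ _, ?_⟩, fun x => ⟨‖σ x‖ * max 1 ‖σ x‖, fun k => ?_⟩⟩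
    · have h' := congrArg (fun τ : M →* ℂ => ‖τ s‖) h
      simp only [norm_normRpowTwist] at h'
      have h'' := (Real.strictMono_rpow_of_base_gt_one hs).injective
        (mul_left_cancel₀ (by positivity) h')
      have h3 : (a : ℝ) + 1 = b + 1 := by simpa using h''
      exact_mod_cast add_right_cancel h3
    · change σ u * ((‖σ u‖ ^ _ : ℝ) : ℂ) = -1
      rw [hσu]
      simp
    · rw [norm_normRpowTwist]
      have hk0 : 0 ≤ 1 / ((k : ℝ) + 1) := by positivity
      have hk1 : 1 / ((k : ℝ) + 1) ≤ 1 := by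
        rw [div_le_one (by positivity)]
        linarith [(Nat.cast_nonneg k : (0 : ℝ) ≤ k)]
      refine mul_le_mul_of_nonneg_left ?_ (norm_nonneg _)
      rcases le_total ‖σ x‖ 1 with h | h
      · exact (Real.rpow_le_one (norm_nonneg _) h hk0).trans (le_max_left _ _)
      · refine le_max_of_le_right ?_
        simpa using Real.rpow_le_rpow_of_exponent_le h hk1

omit [StarMul M] in
/-- Finitely many distinct characters are linearly independent on suitable finitely many points. -/
lemma exists_points_linearIndependent {n : ℕ} (τ : Fin n → M →* ℂ) (hτ : Function.Injective τ) :
    ∃ s : Fin n → M, LinearIndependent ℂ fun j : Fin n => fun i : Fin n => τ i (s j) := by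
  let e : M → Fin n → ℂ := fun s i => τ i s
  have hspan : Submodule.span ℂ (Set.range e) = ⊤ := by
    by_contra hne
    obtain ⟨f, hf, hle⟩ := Submodule.exists_le_ker_of_lt_top _ (lt_top_iff_ne_top.2 hne)
    have hind := (linearIndependent_monoidHom M ℂ).comp τ hτ
    rw [Fintype.linearIndependent_iff] at hind
    have h0 := hind (fun i => f (Pi.single i 1)) <| by
      ext s
      have hs : f (e s) = 0 := hle (Submodule.subset_span ⟨s, rfl⟩)
      rw [LinearMap.pi_apply_eq_sum_univ f] at hs
      simp only [Finset.sum_apply, Pi.smul_apply, Function.comp_apply, Pi.zero_apply]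
      rw [← hs]
      refine Finset.sum_congr rfl fun i _ => ?_
      rw [smul_eq_mul, smul_eq_mul, mul_comm]
      congr 2
      ext j
      simp [Pi.single_apply, eq_comm]
    exact hf (LinearMap.pi_ext' fun i => LinearMap.ext_ring (h0 i))
  obtain ⟨f, hf, -, hind⟩ := Submodule.exists_fun_fin_finrank_span_eq ℂ (Set.range e)
  choose s hs using hf
  have hn : n = Module.finrank ℂ (Submodule.span ℂ (Set.range e)) := by
    rw [hspan, finrank_top, Module.finrank_fin_fun]
  refine ⟨s ∘ Fin.cast hn, ?_⟩
  have hse : (fun j i => τ i ((s ∘ Fin.cast hn) j)) = f ∘ Fin.cast hn :=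
    funext fun j => hs (Fin.cast hn j)
  rw [hse]
  exact hind.comp _ (Fin.cast_injective hn)

lemma hasSum_hermitianForm {τ : ℕ → M →* ℂ} (hτ : ∀ k, τ k ∈ starCharacters M)
    {φ : M → ℂ} (hφ : ∀ s, HasSum (fun k => (1 / 2 : ℂ) ^ k * τ k s) (φ s))
    {n : ℕ} (s : Fin n → M) (ξ : Fin n → ℂ) :
    HasSum (fun k => (((1 / 2) ^ k * Complex.normSq (∑ i, ξ i * τ k (s i)) : ℝ) : ℂ))
      (∑ i, ∑ j, ξ i * starRingEnd ℂ (ξ j) * φ (star (s j) * s i)) := by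
  have h := hasSum_sum (s := Finset.univ) fun i _ => hasSum_sum (s := Finset.univ) fun j _ =>
    (hφ (star (s j) * s i)).mul_left (ξ i * starRingEnd ℂ (ξ j))
  refine h.congr_fun fun k => ?_
  rw [Complex.ofReal_mul, Complex.normSq_eq_conj_mul_self, map_sum, Finset.sum_mul_sum,
    Finset.sum_comm, Finset.mul_sum]
  refine Finset.sum_congr rfl fun i _ => ?_
  rw [Finset.mul_sum]
  refine Finset.sum_congr rfl fun j _ => ?_
  rw [map_mul, map_mul, hτ k (s j)]
  push_cast
  ring

lemma finite_of_hasFinNegSquares {u : M}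
    (H : ∀ φ : M → ℂ, IsPosDefFn (· * ·) star φ →
      HasFinNegSquares (· * ·) star (fun s => φ (s * u))) :
    {σ : M →* ℂ | σ ∈ starCharacters M ∧ σ u = -1}.Finite := by
  by_contra hinf
  obtain ⟨τ, hinj, hτ, hbdd⟩ := exists_bounded_sequence hinf
  have hsum : ∀ s, Summable fun k => (1 / 2 : ℂ) ^ k * τ k s := by
    intro s
    obtain ⟨C, hC⟩ := hbdd s
    refine Summable.of_norm_bounded (summable_geometric_two.mul_right C) fun k => ?_
    rw [norm_mul, norm_pow]
    have : ‖(1 / 2 : ℂ)‖ = 1 / 2 := by norm_num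
    rw [this]
    exact mul_le_mul_of_nonneg_left (hC k) (by positivity)
  let φ : M → ℂ := fun s => ∑' k, (1 / 2 : ℂ) ^ k * τ k s
  have hφ : ∀ s, HasSum (fun k => (1 / 2 : ℂ) ^ k * τ k s) (φ s) := fun s => (hsum s).hasSum
  have hform {n : ℕ} (s : Fin n → M) (ξ : Fin n → ℂ) :=
    (Complex.hasSum_iff _ _).1 (hasSum_hermitianForm (fun k => (hτ k).1) hφ s ξ)
  have hterm (k : ℕ) (c : ℂ) : 0 ≤ (1 / 2 : ℝ) ^ k * Complex.normSq c :=
    mul_nonneg (by positivity) (Complex.normSq_nonneg _)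
  have hpd : IsPosDefFn (· * ·) star φ := by
    intro n s ξ
    obtain ⟨hre, him⟩ := hform s ξ
    refine Complex.le_def.2 ⟨hre.nonneg fun k => hterm _ _, ?_⟩
    simp only [Complex.ofReal_im] at him
    exact hasSum_zero.unique him
  have hφu : ∀ s, φ (s * u) = -φ s := fun s => (hφ (s * u)).unique <| by
    refine (hφ s).neg.congr_fun fun k => ?_
    rw [map_mul, (hτ k).2]
    ring
  have hφstar : ∀ s, φ (star s) = starRingEnd ℂ (φ s) := fun s => (hφ (star s)).unique <| by
    refine (Complex.hasSum_conj'.2 (hφ s)).congr_fun fun k => ?_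
    rw [(hτ k).1 s]
    simp [Complex.conj_ofNat]
  obtain ⟨k, hk⟩ := H φ hpd
  obtain ⟨s, hs⟩ := exists_points_linearIndependent (fun i : Fin (k + 1) => τ i)
    (hinj.comp Fin.val_injective)
  have hA : (Matrix.of fun i j : Fin (k + 1) => φ (s i * star (s j) * u)).IsHermitian := by
    ext i j
    simp only [Matrix.conjTranspose_apply, Matrix.of_apply, hφu, star_neg]
    rw [Complex.star_def, ← hφstar, star_mul', star_star, mul_comm]
  have hneg := negEigCount_eq_of_negDef hA fun x hx => by
    obtain ⟨hre, -⟩ := hform s fun i => starRingEnd ℂ (x i)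
    have hx' : ∃ i : Fin (k + 1), ∑ j, starRingEnd ℂ (x j) * τ i (s j) ≠ 0 := by
      by_contra! h0
      refine hx (funext fun j => ?_)
      have := Fintype.linearIndependent_iff.1 hs (fun j => starRingEnd ℂ (x j))
        (by ext i; simpa using h0 i) j
      simpa using this
    obtain ⟨i, hi⟩ := hx'
    have hlt : 0 < (∑ i, ∑ j, starRingEnd ℂ (x i) * starRingEnd ℂ (starRingEnd ℂ (x j)) *
        φ (star (s j) * s i)).re :=
      (mul_pos (by positivity) (Complex.normSq_pos.2 hi)).trans_le
        (le_hasSum hre (i : ℕ) fun k _ => hterm k _)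
    have heq : star x ⬝ᵥ (Matrix.of (fun i j : Fin (k + 1) => φ (s i * star (s j) * u)) *ᵥ x) =
        -∑ i, ∑ j, starRingEnd ℂ (x i) * starRingEnd ℂ (starRingEnd ℂ (x j)) *
          φ (star (s j) * s i) := by
      rw [star_dotProduct_mulVec_eq_sum, ← Finset.sum_neg_distrib]
      refine Finset.sum_congr rfl fun i _ => ?_
      rw [← Finset.sum_neg_distrib]
      refine Finset.sum_congr rfl fun j _ => ?_
      rw [Matrix.of_apply, hφu, Complex.conj_conj, mul_comm (s i)]
      ring
    rw [heq, Complex.neg_re]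
    linarith
  have := hk (k + 1) s hA
  omega

lemma isChar_iff_exists_starCharacters {σ : M → ℂ} :
    IsChar (· * ·) star σ ↔ ∃ τ ∈ starCharacters M, ⇑τ = σ := by
  constructor
  · rintro ⟨⟨s, hs⟩, hmul, hstar⟩
    have h1 : σ 1 = 1 := by
      have := hmul 1 s
      simp only [one_mul] at this
      exact mul_right_cancel₀ hs (by rw [one_mul, ← this])
    exact ⟨⟨⟨σ, h1⟩, hmul⟩, hstar, rfl⟩
  · rintro ⟨τ, hτ, rfl⟩
    exact ⟨⟨1, by simp⟩, map_mul τ, hτ⟩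

lemma finite_isChar_iff {u : M} :
    {σ : M → ℂ | IsChar (· * ·) star σ ∧ σ u = -1}.Finite ↔
      {σ : M →* ℂ | σ ∈ starCharacters M ∧ σ u = -1}.Finite := by
  rw [← Set.finite_image_iff (f := fun τ : M →* ℂ => (τ : M → ℂ))
    DFunLike.coe_injective.injOn]
  congr! 1
  ext σ
  simp only [Set.mem_ofPred_eq, isChar_iff_exists_starCharacters, Set.mem_image]
  constructor
  · rintro ⟨⟨τ, hτ, rfl⟩, h⟩
    exact ⟨τ, ⟨hτ, h⟩, rfl⟩
  · rintro ⟨τ, ⟨hτ, h⟩, rfl⟩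
    exact ⟨⟨τ, hτ, rfl⟩, h⟩

end Main

/-- Let `S` be a commutative `*`-semigroup with a neutral element `0` and let `u ∈ S`
satisfy `σ(u+u) = 1` and `σ(u) = σ(u*)` for every character `σ` on `S`.  Then
`σ(u) = -1` for only finitely many characters `σ` on `S` iff for every positive
definite `φ : S → ℂ` the function `s ↦ φ(s+u)` has a finite number of negative
squares. -/
theorem stmt1 {S : Type*} (add : S → S → S) (st : S → S)
    (hcomm : ∀ a b, add a b = add b a)
    (hassoc : ∀ a b c, add (add a b) c = add a (add b c))
    (hstadd : ∀ a b, st (add a b) = add (st a) (st b))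
    (hstinv : ∀ a, st (st a) = a)
    (z : S) (hz : ∀ s, add z s = s)
    (u : S)
    (hu : ∀ σ : S → ℂ, IsChar add st σ → σ (add u u) = 1 ∧ σ u = σ (st u)) :
    {σ : S → ℂ | IsChar add st σ ∧ σ u = -1}.Finite ↔
      ∀ φ : S → ℂ, IsPosDefFn add st φ →
        HasFinNegSquares add st (fun s => φ (add s u)) := by
  let : CommMonoid S :=
    { mul := add
      one := z
      mul_assoc := hassoc
      mul_comm := hcomm
      one_mul := hz
      mul_one := fun a => (hcomm a z).trans (hz a) }
  let : StarMul S :=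
    { star := st
      star_involutive := hstinv
      star_mul := fun a b => (hstadd a b).trans (hcomm _ _) }
  refine (finite_isChar_iff (M := S) (u := u)).trans ⟨fun hfin φ hφ => ?_, fun H => ?_⟩
  · exact hasFinNegSquares_of_finite
      (fun σ hσ => (hu σ (isChar_iff_exists_starCharacters.2 ⟨σ, hσ, rfl⟩)).1) hfin hφ
  · exact finite_of_hasFinNegSquares H
end

section
/- Let S be a *-separative commutative *-semigroup with a neutral element 0 and let u ∈ S satisfy u = u* and u + u = 0. Assume the set {s ∈ S : u + s ≠ s} is finite, say of cardinality M. Then M is even, and for every positive definite function φ : S → ℂ the number of negative squares of s ↦ φ(s+u) is at most M/2. -/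
open scoped ComplexOrder

/-- A Hermitian form that is nonnegative on the kernel of a linear map to `ι → ℂ` has at most
`Fintype.card ι` negative eigenvalues. -/
theorem negEigCount_le_of_nonneg_on_ker {n : ℕ} {ι : Type*} [Fintype ι]
    {A : Matrix (Fin n) (Fin n) ℂ} (hA : A.IsHermitian) (L : (Fin n → ℂ) →ₗ[ℂ] (ι → ℂ))
    (hL : ∀ x, L x = 0 → 0 ≤ star x ⬝ᵥ (A.mulVec x)) :
    negEigCount hA ≤ Fintype.card ι := by
  by_contra! hlt
  let N := {i // hA.eigenvalues i < 0}
  let U : Matrix (Fin n) (Fin n) ℂ := hA.eigenvectorUnitary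
  let E : (N → ℂ) →ₗ[ℂ] (Fin n → ℂ) := Function.ExtendByZero.linearMap ℂ Subtype.val
  have hcard : Module.finrank ℂ (ι → ℂ) < Module.finrank ℂ (N → ℂ) := by
    rw [Module.finrank_fintype_fun_eq_card, Module.finrank_fintype_fun_eq_card,
      Fintype.card_subtype]
    exact hlt
  obtain ⟨c, hc, hc0⟩ := (Submodule.ne_bot_iff _).1
    (LinearMap.ker_ne_bot_of_finrank_lt (f := L ∘ₗ U.mulVecLin ∘ₗ E) hcard)
  have hE : ∀ k : N, E c k = c k := fun k => Subtype.val_injective.extend_apply _ _ k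
  have hE0 : ∀ k, ¬ hA.eigenvalues k < 0 → E c k = 0 := fun k hk =>
    Function.extend_apply' _ _ _ (by rintro ⟨a, rfl⟩; exact hk a.2)
  have hform : star (U.mulVec (E c)) ⬝ᵥ A.mulVec (U.mulVec (E c))
      = ((∑ k, hA.eigenvalues k * ‖E c k‖ ^ 2 : ℝ) : ℂ) := by
    have hdiag : U.conjTranspose * A * U
        = Matrix.diagonal (fun k => (hA.eigenvalues k : ℂ)) := by
      have h := hA.conjStarAlgAut_star_eigenvectorUnitary
      rw [Unitary.conjStarAlgAut_star_apply] at h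
      exact h
    rw [Matrix.star_mulVec, ← Matrix.dotProduct_mulVec, Matrix.mulVec_mulVec,
      Matrix.mulVec_mulVec, hdiag]
    simp only [dotProduct, Matrix.mulVec_diagonal, Pi.star_apply, RCLike.star_def]
    push_cast
    refine Finset.sum_congr rfl fun k _ => ?_
    rw [← Complex.conj_mul']
    ring
  have hnonneg := hL _ (LinearMap.mem_ker.1 hc)
  simp only [LinearMap.comp_apply, Matrix.mulVecLin_apply] at hnonneg
  rw [hform, Complex.zero_le_real] at hnonneg
  obtain ⟨k, hk⟩ := Function.ne_iff.1 hc0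
  refine hnonneg.not_gt (Finset.sum_neg' (fun i _ => ?_) ⟨k.1, Finset.mem_univ _, ?_⟩)
  · by_cases hi : hA.eigenvalues i < 0
    · exact mul_nonpos_of_nonpos_of_nonneg hi.le (by positivity)
    · simp [hE0 i hi]
  · rw [hE]
    exact mul_neg_of_neg_of_pos k.2 (by have := norm_pos_iff.2 hk; positivity)

/-- A fixed-point-free involution of a finite set has a transversal containing half of its
points. -/
theorem exists_transversal_of_involution {α : Type*} (g : α → α)
    (hg : ∀ a, g (g a) = a) (T : Finset α) (hT : ∀ a ∈ T, g a ∈ T) (hne : ∀ a ∈ T, g a ≠ a) :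
    ∃ R ⊆ T, R.card + R.card = T.card ∧ ∀ a ∈ T, a ∈ R ∨ g a ∈ R := by
  classical
  induction T using Finset.strongInduction with
  | H T ih =>
    obtain rfl | ⟨a, ha⟩ := T.eq_empty_or_nonempty
    · exact ⟨∅, by simp⟩
    have hga : g a ∈ T.erase a := Finset.mem_erase.2 ⟨hne a ha, hT a ha⟩
    have hsub : (T.erase a).erase (g a) ⊂ T :=
      (Finset.erase_subset _ _).trans_ssubset (Finset.erase_ssubset ha)
    obtain ⟨R, hRT, hR, hcov⟩ := ih _ hsub
      (fun b hb => by
        simp only [Finset.mem_erase] at hb ⊢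
        refine ⟨fun h => hb.2.1 ?_, fun h => hb.1 ?_, hT b hb.2.2⟩
        · rw [← hg b, h, hg]
        · rw [← h, hg])
      (fun b hb => hne b (hsub.1 hb))
    have haR : a ∉ R := fun h => by simpa using hRT h
    refine ⟨insert a R, Finset.insert_subset ha (hRT.trans hsub.1), ?_, fun b hb => ?_⟩
    · have h1 := Finset.card_erase_add_one ha
      have h2 := Finset.card_erase_add_one hga
      rw [Finset.card_insert_of_notMem haR]
      omega
    · by_cases hba : b = a
      · exact .inl (by simp [hba])
      by_cases hbg : b = g a
      · exact .inr (by simp [hbg, hg])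
      · exact (hcov b (by simp [hba, hbg, hb])).imp (Finset.mem_insert_of_mem ·)
          (Finset.mem_insert_of_mem ·)

/-- Let `g` be an involution and `R` a set meeting every nontrivial orbit of `g`. If the weighted
point masses `x j` at `s j` give `r` and `g r` the same total mass for all `r ∈ R`, then the weighted
sum of any function over the points `s j` is unchanged when these are moved by `g`. -/
theorem sum_mul_comp_involution_eq {α κ : Type*} [Fintype κ] [DecidableEq α] (g : α → α)
    (hg : ∀ a, g (g a) = a) (R : Finset α) (hR : ∀ a, g a ≠ a → a ∈ R ∨ g a ∈ R)
    (s : κ → α) (x : κ → ℂ)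
    (hx : ∀ r ∈ R, ∑ j, (if s j = r then x j else 0) = ∑ j, if s j = g r then x j else 0)
    (H : α → ℂ) : ∑ j, x j * H (g (s j)) = ∑ j, x j * H (s j) := by
  have hinv : ∀ a, ∑ j, (if s j = a then x j else 0) = ∑ j, if s j = g a then x j else 0 := by
    intro a
    by_cases ha : g a = a
    · rw [ha]
    rcases hR a ha with h | h
    · exact hx a h
    · simpa [hg] using (hx _ h).symm
  let B : Finset α := Finset.univ.image s ∪ Finset.univ.image fun j => g (s j)
  have hsum : ∀ t : κ → α, (∀ j, t j ∈ B) →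
      ∑ j, x j * H (t j) = ∑ b ∈ B, (∑ j, if t j = b then x j else 0) * H b := by
    intro t ht
    simp only [Finset.sum_mul, ite_mul, zero_mul]
    rw [Finset.sum_comm]
    simp [ht]
  rw [hsum (fun j => g (s j)) (by simp [B]), hsum s (by simp [B])]
  refine Finset.sum_congr rfl fun b _ => ?_
  rw [hinv b]
  have hiff : ∀ j, g (s j) = b ↔ s j = g b := fun j =>
    ⟨fun h => by rw [← h, hg], fun h => by rw [h, hg]⟩
  simp only [hiff]

/-- Let `S` be a `*`-separative commutative `*`-semigroup with a neutral element `0`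
and let `u ∈ S` satisfy `u = u*` and `u + u = 0`.  Assume the set `{s ∈ S : u+s ≠ s}`
is finite, of cardinality `M`.  Then `M` is even, and for every positive definite
`φ : S → ℂ` the number of negative squares of `s ↦ φ(s+u)` is at most `M/2`. -/
theorem stmt3 {S : Type*} (add : S → S → S) (st : S → S)
    (hcomm : ∀ a b, add a b = add b a)
    (hassoc : ∀ a b c, add (add a b) c = add a (add b c))
    (hstadd : ∀ a b, st (add a b) = add (st a) (st b))
    (hstinv : ∀ a, st (st a) = a)
    (z : S) (hz : ∀ s, add z s = s)
    (hsep : ∀ a b : S, a ≠ b → ∃ σ : S → ℂ, IsChar add st σ ∧ σ a ≠ σ b)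
    (u : S) (hu1 : st u = u) (hu2 : add u u = z)
    (hfin : {s : S | add u s ≠ s}.Finite) :
    Even hfin.toFinset.card ∧
      ∀ φ : S → ℂ, IsPosDefFn add st φ →
        NegSquaresLE add st (fun s => φ (add s u)) (hfin.toFinset.card / 2) := by
  classical
  have hinv : ∀ a, add u (add u a) = a := fun a => by rw [← hassoc, hu2, hz]
  obtain ⟨R, -, hRcard, hR⟩ := exists_transversal_of_involution (add u) hinv hfin.toFinset
    (fun a ha => by
      rw [Set.Finite.mem_toFinset] at ha ⊢
      change add u (add u a) ≠ add u a
      rw [hinv]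
      exact Ne.symm ha)
    (fun a ha => by simpa using ha)
  refine ⟨⟨_, hRcard.symm⟩, fun φ hφ n s h => ?_⟩
  let mass : S → (Fin n → ℂ) →ₗ[ℂ] ℂ := fun r =>
    ∑ j, if s j = r then LinearMap.proj j else 0
  have hmass : ∀ r x, mass r x = ∑ j, if s j = r then x j else 0 := by
    intro r x
    simp only [mass, LinearMap.sum_apply]
    exact Finset.sum_congr rfl fun j _ => by split_ifs <;> rfl
  let L : (Fin n → ℂ) →ₗ[ℂ] (R → ℂ) := LinearMap.pi fun r => mass r - mass (add u r)
  have hle : negEigCount h ≤ Fintype.card R := by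
    refine negEigCount_le_of_nonneg_on_ker h L fun x hx => ?_
    have hx' : ∀ r ∈ R, ∑ j, (if s j = r then x j else 0)
        = ∑ j, if s j = add u r then x j else 0 := fun r hr => by
      rw [← hmass, ← hmass]
      exact sub_eq_zero.1 (congrFun hx ⟨r, hr⟩)
    have hshift : ∀ i, ∑ j, x j * φ (add (add (s i) (st (s j))) u)
        = ∑ j, x j * φ (add (s i) (st (s j))) := fun i => by
      rw [← sum_mul_comp_involution_eq (add u) hinv R (fun a ha => hR a (by simpa using ha)) s x
        hx' fun y => φ (add (s i) (st y))]
      refine Finset.sum_congr rfl fun j _ => ?_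
      rw [hstadd, hu1, hcomm u, hassoc]
    have hpos := hφ n s (star x)
    convert hpos using 1
    simp only [dotProduct, Matrix.mulVec, Matrix.of_apply]
    refine Finset.sum_congr rfl fun i _ => ?_
    rw [Finset.sum_congr rfl fun j _ => mul_comm _ (x j), hshift, Finset.mul_sum]
    refine Finset.sum_congr rfl fun j _ => ?_
    rw [hcomm (s i)]
    simp [mul_assoc]
  rw [Fintype.card_coe] at hle
  omega
end

section
/- Let S be a commutative *-semigroup and let H be a *-archimedean component of S. Then every character σ on H (with H regarded as a commutative *-semigroup in its own right) satisfies σ(x) ≠ 0 for every x ∈ H, and there exists a character τ on S with τ(x) = σ(x) for all x ∈ H. -/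
open scoped ComplexOrder

/-- `repAdd add a m` is the `(m+1)`-fold sum `a + a + ⋯ + a`. -/
def repAdd {S : Type*} (add : S → S → S) (a : S) : ℕ → S
  | 0 => a
  | n + 1 => add a (repAdd add a n)

/-- `H` is a `*`-subsemigroup: nonempty and closed under `add` and `st`. -/
def IsStarSubsemigroup {S : Type*} (add : S → S → S) (st : S → S) (H : Set S) : Prop :=
  H.Nonempty ∧ (∀ a ∈ H, ∀ b ∈ H, add a b ∈ H) ∧ ∀ a ∈ H, st a ∈ H

/-- `H` is a `*`-archimedean `*`-subsemigroup: for all `s t ∈ H` there are `m ≥ 1`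
and `x ∈ H` with `m • (s + s*) = t + x`. -/
def IsStarArchimedean {S : Type*} (add : S → S → S) (st : S → S) (H : Set S) : Prop :=
  IsStarSubsemigroup add st H ∧
    ∀ s ∈ H, ∀ t ∈ H, ∃ (m : ℕ) (x : S), x ∈ H ∧ repAdd add (add s (st s)) m = add t x

/-- `H` is a `*`-archimedean component: a maximal `*`-archimedean `*`-subsemigroup. -/
def IsArchComponent {S : Type*} (add : S → S → S) (st : S → S) (H : Set S) : Prop :=
  IsStarArchimedean add st H ∧
    ∀ K : Set S, IsStarArchimedean add st K → H ⊆ K → K = H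

/-- `σ` restricted to `H` is a character of the `*`-semigroup `H`. -/
def IsCharOn {S : Type*} (add : S → S → S) (st : S → S) (H : Set S) (σ : S → ℂ) : Prop :=
  (∃ x ∈ H, σ x ≠ 0) ∧ (∀ a ∈ H, ∀ b ∈ H, σ (add a b) = σ a * σ b) ∧
    ∀ a ∈ H, σ (st a) = starRingEnd ℂ (σ a)

/-- `a` absorbs `b` if `b` is a summand of some multiple of `a + a*`. -/
def StarAbsorbs {S : Type*} (add : S → S → S) (st : S → S) (a b : S) : Prop :=
  ∃ (m : ℕ) (x : S), repAdd add (add a (st a)) m = add b x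

section

variable {S : Type*} {add : S → S → S} {st : S → S}

theorem repAdd_add_repAdd (hassoc : ∀ a b c, add (add a b) c = add a (add b c))
    (a : S) (m n : ℕ) :
    add (repAdd add a m) (repAdd add a n) = repAdd add a (m + n + 1) := by
  induction m with
  | zero => simp [repAdd]
  | succ k ih =>
    rw [show k + 1 + n + 1 = (k + n + 1) + 1 by omega]
    simp only [repAdd, hassoc, ih]

theorem st_repAdd (hstadd : ∀ a b, st (add a b) = add (st a) (st b)) {a : S}
    (ha : st a = a) (m : ℕ) : st (repAdd add a m) = repAdd add a m := by
  induction m with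
  | zero => exact ha
  | succ k ih => simp only [repAdd, hstadd, ih, ha]

theorem st_add_st (hcomm : ∀ a b, add a b = add b a)
    (hstadd : ∀ a b, st (add a b) = add (st a) (st b))
    (hstinv : ∀ a, st (st a) = a) (a : S) : st (add a (st a)) = add a (st a) := by
  rw [hstadd, hstinv, hcomm]

theorem StarAbsorbs.refl (a : S) : StarAbsorbs add st a a := ⟨0, st a, rfl⟩

theorem StarAbsorbs.of_add_left (hassoc : ∀ a b c, add (add a b) c = add a (add b c))
    {a b c : S} (h : StarAbsorbs add st a (add b c)) : StarAbsorbs add st a b := by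
  obtain ⟨m, x, hx⟩ := h
  exact ⟨m, add c x, by rw [hx, hassoc]⟩

theorem StarAbsorbs.of_add_right (hcomm : ∀ a b, add a b = add b a)
    (hassoc : ∀ a b c, add (add a b) c = add a (add b c))
    {a b c : S} (h : StarAbsorbs add st a (add b c)) : StarAbsorbs add st a c :=
  StarAbsorbs.of_add_left hassoc (c := b) (hcomm b c ▸ h)

theorem StarAbsorbs.add_right (hcomm : ∀ a b, add a b = add b a)
    (hassoc : ∀ a b c, add (add a b) c = add a (add b c))
    {a b c : S} (hb : StarAbsorbs add st a b) (hc : StarAbsorbs add st a c) :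
    StarAbsorbs add st a (add b c) := by
  obtain ⟨m, x, hx⟩ := hb
  obtain ⟨n, y, hy⟩ := hc
  have : Std.Commutative add := ⟨hcomm⟩
  have : Std.Associative add := ⟨hassoc⟩
  refine ⟨m + n + 1, add x y, ?_⟩
  rw [← repAdd_add_repAdd hassoc, hx, hy]
  ac_rfl

theorem StarAbsorbs.star (hcomm : ∀ a b, add a b = add b a)
    (hstadd : ∀ a b, st (add a b) = add (st a) (st b))
    (hstinv : ∀ a, st (st a) = a)
    {a b : S} (h : StarAbsorbs add st a b) : StarAbsorbs add st a (st b) := by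
  obtain ⟨m, x, hx⟩ := h
  exact ⟨m, st x, by
    rw [← hstadd, ← hx, st_repAdd hstadd (st_add_st hcomm hstadd hstinv a)]⟩

theorem StarAbsorbs.repAdd_right (hcomm : ∀ a b, add a b = add b a)
    (hassoc : ∀ a b c, add (add a b) c = add a (add b c))
    {a b : S} (h : StarAbsorbs add st a b) (m : ℕ) :
    StarAbsorbs add st a (repAdd add b m) := by
  induction m with
  | zero => exact h
  | succ k ih => exact h.add_right hcomm hassoc ih

theorem StarAbsorbs.trans (hcomm : ∀ a b, add a b = add b a)
    (hassoc : ∀ a b c, add (add a b) c = add a (add b c))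
    (hstadd : ∀ a b, st (add a b) = add (st a) (st b))
    (hstinv : ∀ a, st (st a) = a)
    {a b c : S} (hab : StarAbsorbs add st a b) (hbc : StarAbsorbs add st b c) :
    StarAbsorbs add st a c := by
  obtain ⟨m, x, hx⟩ := hbc
  have h := (hab.add_right hcomm hassoc (hab.star hcomm hstadd hstinv)).repAdd_right hcomm hassoc m
  rw [hx] at h
  exact h.of_add_left hassoc

theorem isStarArchimedean_setOf_starAbsorbs (hcomm : ∀ a b, add a b = add b a)
    (hassoc : ∀ a b c, add (add a b) c = add a (add b c))
    (hstadd : ∀ a b, st (add a b) = add (st a) (st b))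
    (hstinv : ∀ a, st (st a) = a) (e : S) :
    IsStarArchimedean add st {s | StarAbsorbs add st s e ∧ StarAbsorbs add st e s} := by
  have tr {a b c : S} (hab : StarAbsorbs add st a b) (hbc : StarAbsorbs add st b c) :
      StarAbsorbs add st a c := hab.trans hcomm hassoc hstadd hstinv hbc
  refine ⟨⟨⟨e, .refl e, .refl e⟩, ?_, ?_⟩, ?_⟩
  · rintro a ⟨hae, hea⟩ b ⟨-, heb⟩
    exact ⟨tr ((StarAbsorbs.refl _).of_add_left hassoc) hae, hea.add_right hcomm hassoc heb⟩
  · rintro a ⟨hae, hea⟩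
    refine ⟨tr ?_ hae, hea.star hcomm hstadd hstinv⟩
    simpa only [hstinv] using (StarAbsorbs.refl (add := add) (st a)).star hcomm hstadd hstinv
  · rintro s ⟨hse, hes⟩ t ⟨-, het⟩
    obtain ⟨m, x, hx⟩ := tr hse het
    have hz : repAdd add (add s (st s)) (m + 1) = add t (add x (add s (st s))) := by
      rw [repAdd, hx, hcomm, hassoc]
    refine ⟨m + 1, add x (add s (st s)), ⟨?_, ?_⟩, hz⟩
    · exact tr (((StarAbsorbs.refl _).of_add_right hcomm hassoc).of_add_left hassoc) hse
    · have h := (hes.add_right hcomm hassoc (hes.star hcomm hstadd hstinv)).repAdd_right hcomm hassoc (m + 1)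
      rw [hz] at h
      exact h.of_add_right hcomm hassoc

theorem IsArchComponent.eq_setOf_starAbsorbs (hcomm : ∀ a b, add a b = add b a)
    (hassoc : ∀ a b c, add (add a b) c = add a (add b c))
    (hstadd : ∀ a b, st (add a b) = add (st a) (st b))
    (hstinv : ∀ a, st (st a) = a) {H : Set S} (hH : IsArchComponent add st H)
    {e : S} (he : e ∈ H) :
    {s | StarAbsorbs add st s e ∧ StarAbsorbs add st e s} = H := by
  refine hH.2 _ (isStarArchimedean_setOf_starAbsorbs hcomm hassoc hstadd hstinv e) ?_
  intro s hs
  obtain ⟨m, x, -, hx⟩ := hH.1.2 s hs e he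
  obtain ⟨n, y, -, hy⟩ := hH.1.2 e he s hs
  exact ⟨⟨m, x, hx⟩, ⟨n, y, hy⟩⟩

/-- A summand of an element of an archimedean component translates the component into itself. -/
theorem IsArchComponent.add_mem_of_add_mem (hcomm : ∀ a b, add a b = add b a)
    (hassoc : ∀ a b c, add (add a b) c = add a (add b c))
    (hstadd : ∀ a b, st (add a b) = add (st a) (st b))
    (hstinv : ∀ a, st (st a) = a) {H : Set S} (hH : IsArchComponent add st H)
    {e t u : S} (he : e ∈ H) (htu : add t u ∈ H) : add t e ∈ H := by
  rw [← hH.eq_setOf_starAbsorbs hcomm hassoc hstadd hstinv he] at htu ⊢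
  exact ⟨(StarAbsorbs.refl _).of_add_right hcomm hassoc,
    (htu.2.of_add_left hassoc).add_right hcomm hassoc (.refl e)⟩

theorem IsCharOn.ne_zero {H : Set S} (hH : IsStarArchimedean add st H) {σ : S → ℂ}
    (hσ : IsCharOn add st H σ) {x : S} (hx : x ∈ H) : σ x ≠ 0 := by
  obtain ⟨⟨a, ha, hane⟩, hmul, hstar⟩ := hσ
  obtain ⟨⟨-, hadd, hst⟩, harch⟩ := hH
  have hb : add a (st a) ∈ H := hadd _ ha _ (hst _ ha)
  have hbne : σ (add a (st a)) ≠ 0 := by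
    rw [hmul _ ha _ (hst _ ha), hstar _ ha]
    exact mul_ne_zero hane (by simpa using hane)
  have hrep (m : ℕ) : repAdd add (add a (st a)) m ∈ H ∧
      σ (repAdd add (add a (st a)) m) ≠ 0 := by
    induction m with
    | zero => exact ⟨hb, hbne⟩
    | succ k ih =>
      exact ⟨hadd _ hb _ ih.1, by
        rw [repAdd, hmul _ hb _ ih.1]
        exact mul_ne_zero hbne ih.2⟩
  obtain ⟨m, y, hy, hm⟩ := harch a ha x hx
  have h := (hrep m).2
  rw [hm, hmul _ hx _ hy] at h
  exact left_ne_zero_of_mul h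

end

/-- Let `S` be a commutative `*`-semigroup and let `H` be a `*`-archimedean component
of `S`.  Then every character `σ` on `H` (with `H` regarded as a commutative
`*`-semigroup in its own right) satisfies `σ x ≠ 0` for every `x ∈ H`, and there is a
character `τ` on `S` with `τ x = σ x` for all `x ∈ H`. -/
theorem stmt5 {S : Type*} (add : S → S → S) (st : S → S)
    (hcomm : ∀ a b, add a b = add b a)
    (hassoc : ∀ a b c, add (add a b) c = add a (add b c))
    (hstadd : ∀ a b, st (add a b) = add (st a) (st b))
    (hstinv : ∀ a, st (st a) = a)
    (H : Set S) (hH : IsArchComponent add st H)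
    (σ : S → ℂ) (hσ : IsCharOn add st H σ) :
    (∀ x ∈ H, σ x ≠ 0) ∧
      ∃ τ : S → ℂ, IsChar add st τ ∧ ∀ x ∈ H, τ x = σ x := by
  classical
  have hne : ∀ x ∈ H, σ x ≠ 0 := fun x hx => hσ.ne_zero hH.1 hx
  refine ⟨hne, ?_⟩
  obtain ⟨-, hmul, hstar⟩ := hσ
  obtain ⟨⟨e, he⟩, hadd, hst⟩ := hH.1.1
  have : Std.Commutative add := ⟨hcomm⟩
  have : Std.Associative add := ⟨hassoc⟩
  have mem {t u : S} (h : add t u ∈ H) : add t e ∈ H :=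
    hH.add_mem_of_add_mem hcomm hassoc hstadd hstinv he h
  have hee := hne e he
  have ext : ∀ x ∈ H, (if add x e ∈ H then σ (add x e) / σ e else 0) = σ x := fun x hx => by
    rw [if_pos (hadd x hx e he), hmul x hx e he, mul_div_cancel_right₀ _ hee]
  refine ⟨fun t => if add t e ∈ H then σ (add t e) / σ e else 0, ⟨⟨e, ?_⟩, ?_, ?_⟩, ext⟩
  · simpa only [ext e he] using hee
  · intro a b
    by_cases hab : add (add a b) e ∈ H
    · have ha : add a e ∈ H := mem (u := add b e) (by rwa [← hassoc])
      have hb : add b e ∈ H := mem (u := add a e) (by rwa [← hassoc, hcomm b a])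
      have key : σ (add (add a b) e) * σ e = σ (add a e) * σ (add b e) := by
        rw [← hmul _ hab _ he, ← hmul _ ha _ hb]
        congr 1
        ac_rfl
      simp only [if_pos hab, if_pos ha, if_pos hb]
      field_simp
      exact key
    · have hnot : ¬ (add a e ∈ H ∧ add b e ∈ H) := fun ⟨ha, hb⟩ =>
        hab (mem (u := add e e) (by
          have h := hadd _ ha _ hb
          rwa [show add (add a e) (add b e) = add (add a b) (add e e) by ac_rfl] at h))
      simp only [if_neg hab]
      by_cases ha : add a e ∈ H
      · have hb : add b e ∉ H := fun hb => hnot ⟨ha, hb⟩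
        simp [hb]
      · simp [ha]
  · intro a
    have mem_star {a : S} (ha : add a e ∈ H) : add (st a) e ∈ H :=
      mem (u := st e) (hstadd a e ▸ hst _ ha)
    by_cases ha : add a e ∈ H
    · have ha' := mem_star ha
      have key : σ (add (st a) e) * σ (st e) = σ (st (add a e)) * σ e := by
        rw [← hmul _ ha' _ (hst _ he), ← hmul _ (hst _ ha) _ he, hstadd]
        congr 1
        ac_rfl
      rw [hstar _ he, hstar _ ha] at key
      have hee' : starRingEnd ℂ (σ e) ≠ 0 := by simpa using hee
      simp only [if_pos ha, if_pos ha', map_div₀]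
      rw [div_eq_div_iff hee hee']
      exact key
    · have ha' : add (st a) e ∉ H := fun h => ha (hstinv a ▸ mem_star h)
      simp [ha, ha']
end

section
/- Let S be a commutative *-semigroup with a neutral element 0 and let u ∈ S satisfy u + u = 0. Then every *-archimedean component of S containing 0 also contains u; moreover, u + K ⊆ K for every *-archimedean component K of S. -/
open scoped ComplexOrder

theorem repAdd_add {S : Type*} (add : S → S → S) [Std.Commutative add] [Std.Associative add]
    (a b : S) (m : ℕ) : repAdd add (add a b) m = add (repAdd add a m) (repAdd add b m) := by
  induction m with
  | zero => rfl
  | succ n ih => simp only [repAdd, ih]; ac_rfl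

theorem repAdd_mem {S : Type*} (add : S → S → S) {G : Set S}
    (hG : ∀ a ∈ G, ∀ b ∈ G, add a b ∈ G) {a : S} (ha : a ∈ G) (m : ℕ) : repAdd add a m ∈ G := by
  induction m with
  | zero => exact ha
  | succ n ih => exact hG _ ha _ ih

/-- Translating a `*`-archimedean `*`-subsemigroup by a `*`-subsemigroup of elements of order
at most two gives a `*`-archimedean `*`-subsemigroup. -/
theorem IsStarArchimedean.image2_add {S : Type*} {add : S → S → S} {st : S → S}
    [Std.Commutative add] [Std.Associative add]
    (hstadd : ∀ a b, st (add a b) = add (st a) (st b))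
    {z : S} (hz : ∀ s, add z s = s) {G K : Set S} (hG : IsStarSubsemigroup add st G)
    (hG2 : ∀ g ∈ G, add g g = z) (hK : IsStarArchimedean add st K) :
    IsStarArchimedean add st (Set.image2 add G K) := by
  obtain ⟨hGne, hGadd, hGst⟩ := hG
  obtain ⟨⟨hKne, hKadd, hKst⟩, harch⟩ := hK
  refine ⟨⟨hGne.image2 hKne, ?_, ?_⟩, ?_⟩
  · rintro _ ⟨g, hg, k, hk, rfl⟩ _ ⟨h, hh, l, hl, rfl⟩
    exact ⟨add g h, hGadd g hg h hh, add k l, hKadd k hk l hl, by ac_rfl⟩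
  · rintro _ ⟨g, hg, k, hk, rfl⟩
    exact ⟨st g, hGst g hg, st k, hKst k hk, (hstadd g k).symm⟩
  · rintro _ ⟨g, hg, k, hk, rfl⟩ _ ⟨h, hh, l, hl, rfl⟩
    obtain ⟨m, x, hx, hmx⟩ := harch k hk l hl
    have he := repAdd_mem add hGadd (hGadd g hg _ (hGst g hg)) m
    refine ⟨m, add (add (repAdd add (add g (st g)) m) h) x,
      ⟨_, hGadd _ he h hh, x, hx, rfl⟩, ?_⟩
    have hsum : add (add g k) (st (add g k)) = add (add g (st g)) (add k (st k)) := by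
      rw [hstadd]; ac_rfl
    rw [hsum, repAdd_add, hmx]
    generalize repAdd add (add g (st g)) m = e
    calc add e (add l x) = add (add h h) (add e (add l x)) := by rw [hG2 h hh, hz]
      _ = add (add h l) (add (add e h) x) := by ac_rfl

/-- Let `S` be a commutative `*`-semigroup with a neutral element `0` and let `u ∈ S`
satisfy `u + u = 0`.  Then every `*`-archimedean component of `S` containing `0` also
contains `u`; moreover, `u + K ⊆ K` for every `*`-archimedean component `K` of `S`. -/
theorem stmt6 {S : Type*} (add : S → S → S) (st : S → S)
    (hcomm : ∀ a b, add a b = add b a)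
    (hassoc : ∀ a b c, add (add a b) c = add a (add b c))
    (hstadd : ∀ a b, st (add a b) = add (st a) (st b))
    (hstinv : ∀ a, st (st a) = a)
    (z : S) (hz : ∀ s, add z s = s)
    (u : S) (hu : add u u = z) :
    (∀ H : Set S, IsArchComponent add st H → z ∈ H → u ∈ H) ∧
      ∀ K : Set S, IsArchComponent add st K → ∀ k ∈ K, add u k ∈ K := by
  have : Std.Commutative add := ⟨hcomm⟩
  have : Std.Associative add := ⟨hassoc⟩
  have hstz : st z = z := by
    calc st z = add z (st z) := (hz _).symm
      _ = st (add (st z) z) := by rw [hstadd, hstinv, hcomm]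
      _ = z := by rw [hcomm, hz, hstinv]
  have hG : IsStarSubsemigroup add st {g | add g g = z} := by
    refine ⟨⟨u, hu⟩, fun a ha b hb => ?_, fun a ha => ?_⟩
    · change add a a = z at ha
      change add b b = z at hb
      change add (add a b) (add a b) = z
      calc add (add a b) (add a b) = add (add a a) (add b b) := by ac_rfl
        _ = z := by rw [ha, hb, hz]
    · change add a a = z at ha
      change add (st a) (st a) = z
      rw [← hstadd, ha, hstz]
  have htrans : ∀ K : Set S, IsArchComponent add st K → ∀ k ∈ K, add u k ∈ K := by
    intro K hK k hk
    have heq := hK.2 _ (hK.1.image2_add hstadd hz hG fun _ hg => hg)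
      fun l hl => ⟨z, hz z, l, hl, hz l⟩
    rw [← heq]
    exact ⟨u, hu, k, hk, rfl⟩
  refine ⟨fun H hH hzH => ?_, htrans⟩
  simpa only [hcomm u z, hz] using htrans H hH z hzH
end

section
/- Let S be a *-separative commutative *-semigroup with a neutral element 0 and let u ∈ S satisfy u = u* and u + u = 0. Let S_i and S_j be *-archimedean components of S with S_i + S_j ⊆ S_j. If u + s = s for some s ∈ S_i, then u + s₀ = s₀ for every s₀ ∈ S_j. -/
open scoped ComplexOrder

/-- A character that does not vanish at `a` does not vanish at any multiple of `a`. -/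
theorem IsChar.repAdd_ne_zero {S : Type*} {add : S → S → S} {st : S → S} {σ : S → ℂ}
    (hσ : IsChar add st σ) {a : S} (ha : σ a ≠ 0) (n : ℕ) : σ (repAdd add a n) ≠ 0 := by
  induction n with
  | zero => exact ha
  | succ n ih =>
    rw [repAdd, hσ.2.1]
    exact mul_ne_zero ha ih

/-- Let `S` be a `*`-separative commutative `*`-semigroup with a neutral element `0`
and let `u ∈ S` satisfy `u = u*` and `u + u = 0`.  Let `Si` and `Sj` be
`*`-archimedean components of `S` with `Si + Sj ⊆ Sj`.  If `u + s = s` for some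
`s ∈ Si`, then `u + s₀ = s₀` for every `s₀ ∈ Sj`. -/
theorem stmt7 {S : Type*} (add : S → S → S) (st : S → S)
    (hcomm : ∀ a b, add a b = add b a)
    (hassoc : ∀ a b c, add (add a b) c = add a (add b c))
    (hstadd : ∀ a b, st (add a b) = add (st a) (st b))
    (hstinv : ∀ a, st (st a) = a)
    (z : S) (hz : ∀ s, add z s = s)
    (hsep : ∀ a b : S, a ≠ b → ∃ σ : S → ℂ, IsChar add st σ ∧ σ a ≠ σ b)
    (u : S) (hu1 : st u = u) (hu2 : add u u = z)
    (Si Sj : Set S) (hSi : IsArchComponent add st Si) (hSj : IsArchComponent add st Sj)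
    (hsum : ∀ a ∈ Si, ∀ b ∈ Sj, add a b ∈ Sj)
    (s : S) (hs : s ∈ Si) (hfix : add u s = s) :
    ∀ s₀ ∈ Sj, add u s₀ = s₀ := by
  intro s₀ hs₀
  by_contra hne
  obtain ⟨σ, hσ, hσne⟩ := hsep _ _ hne
  rw [hσ.2.1] at hσne
  have h₀ : σ s₀ ≠ 0 := fun h => hσne (by simp [h])
  obtain ⟨m, x, -, hx⟩ := hSj.1.2 s₀ hs₀ (add s s₀) (hsum s hs s₀ hs₀)
  have hm : σ (add (add s s₀) x) ≠ 0 := by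
    rw [← hx]
    refine hσ.repAdd_ne_zero ?_ m
    rw [hσ.2.1, hσ.2.2]
    exact mul_ne_zero h₀ ((map_ne_zero _).2 h₀)
  rw [hσ.2.1, hσ.2.1] at hm
  have hu : σ u * σ s = σ s := by rw [← hσ.2.1, hfix]
  have hu' : σ u = 1 := (mul_eq_right₀ (left_ne_zero_of_mul (left_ne_zero_of_mul hm))).1 hu
  exact hσne (by rw [hu', one_mul])
end

section
/- If S and T are *-separative commutative *-semigroups and h : S → T is a *-homomorphism, then the commutative *-semigroup U(S,T,h) is *-separative. -/
open scoped ComplexOrder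

/-- Addition of the `*`-semigroup `U(S,T,h)` on the disjoint union `S ⊕ T`. -/
def uAdd {S T : Type*} (addS : S → S → S) (addT : T → T → T) (h : S → T) :
    S ⊕ T → S ⊕ T → S ⊕ T
  | Sum.inl a, Sum.inl b => Sum.inl (addS a b)
  | Sum.inl a, Sum.inr b => Sum.inr (addT (h a) b)
  | Sum.inr a, Sum.inl b => Sum.inr (addT a (h b))
  | Sum.inr a, Sum.inr b => Sum.inr (addT a b)

/-- Involution of the `*`-semigroup `U(S,T,h)`. -/
def uStar {S T : Type*} (stS : S → S) (stT : T → T) : S ⊕ T → S ⊕ T :=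
  Sum.map stS stT

/-- A character of `S`, extended by zero on `T`, is a character of `U(S,T,h)`. -/
lemma IsChar.extendByZero {S T : Type*} {addS : S → S → S} {stS : S → S} {σ : S → ℂ}
    (hσ : IsChar addS stS σ) (addT : T → T → T) (stT : T → T) (h : S → T) :
    IsChar (uAdd addS addT h) (uStar stS stT) (Sum.elim σ fun _ => 0) := by
  obtain ⟨⟨s, hs⟩, hadd, hst⟩ := hσ
  refine ⟨⟨Sum.inl s, hs⟩, ?_, ?_⟩
  · rintro (a | a) (b | b) <;> simp [uAdd, hadd]
  · rintro (a | a) <;> simp [uStar, hst]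

/-- A character `τ` of `T`, extended by `τ ∘ h` on `S`, is a character of `U(S,T,h)`. -/
lemma IsChar.extendByComp {S T : Type*} {addS : S → S → S} {stS : S → S}
    {addT : T → T → T} {stT : T → T} {τ : T → ℂ} (hτ : IsChar addT stT τ) {h : S → T}
    (hadd : ∀ a b, h (addS a b) = addT (h a) (h b)) (hst : ∀ a, h (stS a) = stT (h a)) :
    IsChar (uAdd addS addT h) (uStar stS stT) (Sum.elim (τ ∘ h) τ) := by
  obtain ⟨⟨t, ht⟩, hτadd, hτst⟩ := hτ
  refine ⟨⟨Sum.inr t, ht⟩, ?_, ?_⟩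
  · rintro (a | a) (b | b) <;> simp [uAdd, hadd, hτadd]
  · rintro (a | a) <;> simp [uStar, hst, hτst]

/-- The constant function `1` is a character of a nonempty `*`-semigroup. -/
lemma isChar_one {S : Type*} [Nonempty S] (add : S → S → S) (st : S → S) :
    IsChar add st fun _ => 1 :=
  ⟨⟨Classical.arbitrary S, one_ne_zero⟩, by simp, by simp⟩

/-- If `S` and `T` are `*`-separative commutative `*`-semigroups and `h : S → T` is a
`*`-homomorphism, then the commutative `*`-semigroup `U(S,T,h)` is `*`-separative. -/
theorem stmt8 {S T : Type*}
    (addS : S → S → S) (stS : S → S)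
    (hcommS : ∀ a b, addS a b = addS b a)
    (hassocS : ∀ a b c, addS (addS a b) c = addS a (addS b c))
    (hstaddS : ∀ a b, stS (addS a b) = addS (stS a) (stS b))
    (hstinvS : ∀ a, stS (stS a) = a)
    (addT : T → T → T) (stT : T → T)
    (hcommT : ∀ a b, addT a b = addT b a)
    (hassocT : ∀ a b c, addT (addT a b) c = addT a (addT b c))
    (hstaddT : ∀ a b, stT (addT a b) = addT (stT a) (stT b))
    (hstinvT : ∀ a, stT (stT a) = a)
    (hsepS : ∀ a b : S, a ≠ b → ∃ σ : S → ℂ, IsChar addS stS σ ∧ σ a ≠ σ b)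
    (hsepT : ∀ a b : T, a ≠ b → ∃ σ : T → ℂ, IsChar addT stT σ ∧ σ a ≠ σ b)
    (h : S → T)
    (hhom_add : ∀ a b, h (addS a b) = addT (h a) (h b))
    (hhom_star : ∀ a, h (stS a) = stT (h a)) :
    ∀ x y : S ⊕ T, x ≠ y →
      ∃ σ : S ⊕ T → ℂ, IsChar (uAdd addS addT h) (uStar stS stT) σ ∧ σ x ≠ σ y := by
  rintro (a | a) (b | b) hne
  · obtain ⟨σ, hσ, hab⟩ := hsepS a b (by simpa using hne)
    exact ⟨_, hσ.extendByZero addT stT h, hab⟩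
  · have : Nonempty S := ⟨a⟩
    exact ⟨_, (isChar_one addS stS).extendByZero addT stT h, by simp⟩
  · have : Nonempty S := ⟨b⟩
    exact ⟨_, (isChar_one addS stS).extendByZero addT stT h, by simp⟩
  · obtain ⟨τ, hτ, hab⟩ := hsepT a b (by simpa using hne)
    exact ⟨_, hτ.extendByComp hhom_add hhom_star, hab⟩
end

section
/- Let S = ℤ/4ℤ × ℕ with componentwise addition and the identical involution s* = s, and let u = (2,0). Then u + s ≠ s for every s ∈ S, while σ(u) = 1 for every character σ on S; in particular σ(u+s) = σ(s) for every character σ on S and every s ∈ S. -/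
open scoped ComplexOrder

/-- A character of `ZMod 4 × ℕ` with the identical involution takes the value `1` at `(2, 0)`. -/
theorem IsChar.apply_two_zero {σ : ZMod 4 × ℕ → ℂ} (hσ : IsChar (· + ·) id σ) :
    σ (2, 0) = 1 := by
  obtain ⟨⟨s, hs⟩, hadd, hstar⟩ := hσ
  have hzero : σ (0, 0) = 1 := by
    have h := hadd (0, 0) s
    have hs' : ((0, 0) : ZMod 4 × ℕ) + s = s := zero_add s
    simp only [hs'] at h
    exact mul_right_cancel₀ hs (by rw [← h, one_mul])
  have htwo : σ (2, 0) = σ (1, 0) * σ (1, 0) := hadd (1, 0) (1, 0)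
  have hfour : σ (0, 0) = σ (2, 0) * σ (2, 0) := hadd (2, 0) (2, 0)
  obtain ⟨x, hx⟩ := Complex.conj_eq_iff_real.mp (hstar (1, 0)).symm
  rw [hzero, htwo, hx] at hfour
  rw [htwo, hx]
  norm_cast at hfour ⊢
  nlinarith [mul_self_nonneg x]

/-- Let `S = ℤ/4ℤ × ℕ` with componentwise addition and the identical involution, and
let `u = (2,0)`.  Then `u + s ≠ s` for every `s ∈ S`, while `σ u = 1` for every
character `σ` on `S`; in particular `σ (u+s) = σ s` for every character `σ` and
every `s`. -/
theorem stmt9 :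
    (∀ s : ZMod 4 × ℕ, ((2, 0) : ZMod 4 × ℕ) + s ≠ s) ∧
      (∀ σ : ZMod 4 × ℕ → ℂ, IsChar (· + ·) id σ → σ (2, 0) = 1) ∧
      (∀ σ : ZMod 4 × ℕ → ℂ, IsChar (· + ·) id σ →
        ∀ s : ZMod 4 × ℕ, σ (((2, 0) : ZMod 4 × ℕ) + s) = σ s) := by
  refine ⟨fun s h => ?_, fun σ hσ => hσ.apply_two_zero, fun σ hσ s => ?_⟩
  · exact absurd (congrArg Prod.fst (add_eq_right.mp h)) (by decide)
  · exact (hσ.2.1 (2, 0) s).trans (by rw [hσ.apply_two_zero, one_mul])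
end

section
/- Let S = ℤ/2ℤ × ℕ with componentwise addition and the identical involution s* = s, and let u = (1,0). There exists a positive definite function φ : S → ℂ such that the function s ↦ φ(s+u) does not have a finite number of negative squares. -/
open scoped ComplexOrder

/-- A triangular factor of the Hankel matrix `((i + j)!)`. -/
def factorialFactor (i k : ℕ) : ℕ := i.factorial * i.choose k

theorem factorial_add_eq_sum (i j N : ℕ) (hN : i < N) :
    (i + j).factorial = ∑ k ∈ Finset.range N, factorialFactor i k * factorialFactor j k := by
  have hsub : Finset.range (i + 1) ⊆ Finset.range N := Finset.range_mono hN
  rw [← Finset.sum_subset hsub]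
  · have h1 : (i + j).choose i = ∑ k ∈ Finset.range (i + 1), i.choose k * j.choose k := by
      rw [Nat.add_choose_eq, ← Finset.Nat.sum_antidiagonal_swap,
        Finset.Nat.sum_antidiagonal_eq_sum_range_succ_mk]
      refine Finset.sum_congr rfl fun k hk => ?_
      have hki : k ≤ i := by simpa [Nat.lt_succ_iff] using hk
      simp [Nat.choose_symm hki]
    rw [← Nat.add_choose_mul_factorial_mul_factorial i j, ← Nat.choose_symm_add, h1, Finset.sum_mul, Finset.sum_mul]
    refine Finset.sum_congr rfl fun k _ => ?_
    unfold factorialFactor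
    ring
  · intro k _ hk
    have hik : i < k := by simpa using hk
    simp [factorialFactor, Nat.choose_eq_zero_of_lt hik]

/-- The nontrivial character of `ℤ/2ℤ`. -/
def zmodTwoSign (e : ZMod 2) : ℤ := if e = 0 then 1 else -1

theorem zmodTwoSign_add (a b : ZMod 2) :
    zmodTwoSign (a + b) = zmodTwoSign a * zmodTwoSign b := by
  revert a b
  decide

/-- The function `(e, n) ↦ (-1)ᵉ n!`. -/
def signedFactorial (s : ZMod 2 × ℕ) : ℂ := (zmodTwoSign s.1 : ℂ) * (s.2.factorial : ℂ)

theorem signedFactorial_add (s t : ZMod 2 × ℕ) (N : ℕ) (hN : s.2 < N) :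
    signedFactorial (s + t) = ∑ k ∈ Finset.range N,
      ((zmodTwoSign s.1 : ℂ) * (factorialFactor s.2 k : ℂ)) *
        ((zmodTwoSign t.1 : ℂ) * (factorialFactor t.2 k : ℂ)) := by
  simp only [signedFactorial, Prod.fst_add, Prod.snd_add, zmodTwoSign_add,
    factorial_add_eq_sum s.2 t.2 N hN]
  push_cast
  rw [Finset.mul_sum]
  exact Finset.sum_congr rfl fun k _ => by ring

theorem isPosDefFn_signedFactorial : IsPosDefFn (· + ·) id signedFactorial := by
  intro n s ξ
  obtain ⟨N, hN⟩ : ∃ N, ∀ i, (s i).2 < N :=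
    ⟨Finset.univ.sup (fun i => (s i).2) + 1, fun i =>
      Nat.lt_succ_of_le (Finset.le_sup (f := fun i => (s i).2) (Finset.mem_univ i))⟩
  have key : ∑ i, ∑ j, ξ i * starRingEnd ℂ (ξ j) * signedFactorial (id (s j) + s i) =
      ∑ k ∈ Finset.range N,
        (∑ i, ξ i * ((zmodTwoSign (s i).1 : ℂ) * (factorialFactor (s i).2 k : ℂ))) *
        starRingEnd ℂ (∑ i, ξ i * ((zmodTwoSign (s i).1 : ℂ) *
          (factorialFactor (s i).2 k : ℂ))) := by
    simp only [id, signedFactorial_add _ _ N (hN _), map_sum, Finset.sum_mul_sum, map_mul,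
      map_intCast, map_natCast]
    simp only [Finset.mul_sum]
    rw [Finset.sum_comm (s := Finset.range N)]
    refine Finset.sum_congr rfl fun i _ => ?_
    rw [Finset.sum_comm (s := Finset.range N)]
    exact Finset.sum_congr rfl fun j _ => Finset.sum_congr rfl fun k _ => by ring
  rw [key]
  exact Finset.sum_nonneg fun k _ => mul_star_self_nonneg _

theorem posDef_factorial_hankel (n : ℕ) :
    (Matrix.of fun i j : Fin n => (((i + j : ℕ).factorial : ℕ) : ℂ)).PosDef := by
  set L : Matrix (Fin n) (Fin n) ℂ := Matrix.of fun i k => (factorialFactor i k : ℂ) with hL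
  have hdet : L.det ≠ 0 := by
    rw [Matrix.det_of_isLowerTriangular L]
    · refine Finset.prod_ne_zero_iff.mpr fun i _ => ?_
      simp [hL, factorialFactor, Nat.factorial_ne_zero]
    · intro i k hik
      have hik' : (i : ℕ) < k := hik
      simp [hL, factorialFactor, Nat.choose_eq_zero_of_lt hik']
  have heq : (Matrix.of fun i j : Fin n => (((i + j : ℕ).factorial : ℕ) : ℂ)) =
      L * L.conjTranspose := by
    ext i j
    rw [Matrix.of_apply, factorial_add_eq_sum i j n i.2, Matrix.mul_apply,
      ← Fin.sum_univ_eq_sum_range (fun k => factorialFactor i k * factorialFactor j k)]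
    simp [hL]
  rw [heq]
  refine Matrix.PosDef.mul_conjTranspose_self L ?_
  exact Matrix.vecMul_injective_of_isUnit
    ((Matrix.isUnit_iff_isUnit_det _).mpr (isUnit_iff_ne_zero.mpr hdet))

theorem negEigCount_eq_of_posDef_neg {n : ℕ} {A : Matrix (Fin n) (Fin n) ℂ}
    (hA : A.IsHermitian) (h : (-A).PosDef) : negEigCount hA = n := by
  have hneg : ∀ i, hA.eigenvalues i < 0 := by
    intro i
    have hv : (hA.eigenvectorBasis i).ofLp ≠ 0 := by
      simpa using hA.eigenvectorBasis.orthonormal.ne_zero i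
    have hpos := h.re_dotProduct_pos hv
    rw [Matrix.neg_mulVec, dotProduct_neg, map_neg] at hpos
    rw [hA.eigenvalues_eq i]
    linarith
  simp [negEigCount, hneg]

/-- Let `S = ℤ/2ℤ × ℕ` with componentwise addition and the identical involution, and
let `u = (1,0)`.  There exists a positive definite `φ : S → ℂ` such that `s ↦ φ(s+u)`
does not have a finite number of negative squares. -/
theorem stmt10 :
    ∃ φ : ZMod 2 × ℕ → ℂ, IsPosDefFn (· + ·) id φ ∧
      ¬ HasFinNegSquares (· + ·) id (fun s => φ (s + (1, 0))) := by
  refine ⟨signedFactorial, isPosDefFn_signedFactorial, ?_⟩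
  rintro ⟨k, hk⟩
  set M : Matrix (Fin (k + 1)) (Fin (k + 1)) ℂ := Matrix.of fun i j =>
    signedFactorial (((0 : ZMod 2), (i : ℕ)) + id ((0 : ZMod 2), (j : ℕ)) + (1, 0)) with hM
  have hneg : (-M).PosDef := by
    convert posDef_factorial_hankel (k + 1) using 1
    ext i j
    simp [hM, signedFactorial, zmodTwoSign]
  have hherm : M.IsHermitian := by simpa using hneg.isHermitian.neg
  have hle := hk (k + 1) (fun i => (0, i)) hherm
  rw [negEigCount_eq_of_posDef_neg hherm hneg] at hle
  omega
end

section
/- Let S = U(ℤ/2ℤ, ℕ, h₀), where ℤ/2ℤ and ℕ carry their usual additions and the identical involutions and h₀ : ℤ/2ℤ → ℕ is the constant zero *-homomorphism; the element 0 ∈ ℤ/2ℤ is the neutral element of S. Let u = 1 ∈ ℤ/2ℤ, viewed as an element of S. Then for every positive definite function φ : S → ℂ the number of negative squares of s ↦ φ(s+u) is at most 1. -/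
open scoped ComplexOrder

open Matrix in
/-- A Hermitian matrix whose quadratic form is nonnegative on the kernel of a linear functional
has at most one negative eigenvalue. -/
theorem negEigCount_le_one_of_nonneg_on_ker {n : ℕ} {A : Matrix (Fin n) (Fin n) ℂ}
    (hA : A.IsHermitian) (l : (Fin n → ℂ) →ₗ[ℂ] ℂ)
    (hl : ∀ x, l x = 0 → 0 ≤ star x ⬝ᵥ (A *ᵥ x)) : negEigCount hA ≤ 1 := by
  refine Finset.card_le_one.2 fun i hi j hj => ?_
  simp only [Finset.mem_filter, Finset.mem_univ, true_and] at hi hj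
  by_contra hij
  set w : Fin n → Fin n → ℂ := fun k => ⇑(hA.eigenvectorBasis k) with hw
  have hAw (k : Fin n) : A *ᵥ w k = (hA.eigenvalues k : ℂ) • w k := by
    have := hA.mulVec_eigenvectorBasis k
    simpa [hw] using this
  have horth (p q : Fin n) : star (w p) ⬝ᵥ w q = if p = q then 1 else 0 := by
    rw [← orthonormal_iff_ite.1 hA.eigenvectorBasis.orthonormal p q,
      EuclideanSpace.inner_eq_star_dotProduct, dotProduct_comm]
  obtain ⟨a, b, hab, hne⟩ : ∃ a b : ℂ, a * l (w i) + b * l (w j) = 0 ∧ (a ≠ 0 ∨ b ≠ 0) := by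
    by_cases h : l (w i) = 0
    · exact ⟨1, 0, by simp [h], by simp⟩
    · exact ⟨-l (w j), l (w i), by ring, Or.inr h⟩
  have hform := hl (a • w i + b • w j) (by simpa using hab)
  have hval : star (a • w i + b • w j) ⬝ᵥ (A *ᵥ (a • w i + b • w j)) =
      ((Complex.normSq a * hA.eigenvalues i + Complex.normSq b * hA.eigenvalues j : ℝ) : ℂ) := by
    simp only [mulVec_add, mulVec_smul, hAw, star_add, star_smul, add_dotProduct, dotProduct_add,
      smul_dotProduct, dotProduct_smul, horth, hij, Ne.symm hij, if_true, if_false, smul_eq_mul]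
    push_cast
    rw [Complex.normSq_eq_conj_mul_self, Complex.normSq_eq_conj_mul_self]
    simp only [RCLike.star_def]
    ring
  rw [hval, Complex.zero_le_real] at hform
  rcases hne with h | h
  · nlinarith [mul_neg_of_pos_of_neg (Complex.normSq_pos.2 h) hi,
      mul_nonpos_of_nonneg_of_nonpos (Complex.normSq_nonneg b) hj.le]
  · nlinarith [mul_neg_of_pos_of_neg (Complex.normSq_pos.2 h) hj,
      mul_nonpos_of_nonneg_of_nonpos (Complex.normSq_nonneg a) hi.le]

/-- The sign character of `ℤ/2ℤ`, extended by zero to `U(ℤ/2ℤ, ℕ, h₀)`. -/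
def signChar : ZMod 2 ⊕ ℕ → ℂ
  | Sum.inl a => if a = 0 then 1 else -1
  | Sum.inr _ => 0

/-- Translating the kernel of `φ` by `u` changes it by a kernel of rank one. -/
theorem translate_eq_sub (φ : ZMod 2 ⊕ ℕ → ℂ) (s t : ZMod 2 ⊕ ℕ) :
    φ (uAdd (· + ·) (· + ·) (fun _ : ZMod 2 => (0 : ℕ))
        (uAdd (· + ·) (· + ·) (fun _ : ZMod 2 => (0 : ℕ)) s (uStar id id t)) (Sum.inl 1)) =
      φ (uAdd (· + ·) (· + ·) (fun _ : ZMod 2 => (0 : ℕ)) (uStar id id s) t) -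
        (φ (Sum.inl 0) - φ (Sum.inl 1)) * signChar s * signChar t := by
  have h2 : (1 + 1 : ZMod 2) = 0 := by decide
  rcases s with a | m <;> rcases t with b | k
  · have hcases : ∀ c : ZMod 2, c = 0 ∨ c = 1 := by decide
    rcases hcases a with rfl | rfl <;> rcases hcases b with rfl | rfl <;>
      simp [uAdd, uStar, signChar, h2]
  all_goals simp [uAdd, uStar, signChar]

/-- Let `S = U(ℤ/2ℤ, ℕ, h₀)` where `h₀` is the constant zero `*`-homomorphism and both
semigroups carry the identical involution, and let `u = 1 ∈ ℤ/2ℤ ⊆ S`.  Then for every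
positive definite `φ : S → ℂ` the number of negative squares of `s ↦ φ(s+u)` is at
most `1`. -/
theorem stmt11 :
    ∀ φ : ZMod 2 ⊕ ℕ → ℂ,
      IsPosDefFn (uAdd (· + ·) (· + ·) (fun _ : ZMod 2 => (0 : ℕ))) (uStar id id) φ →
      NegSquaresLE (uAdd (· + ·) (· + ·) (fun _ : ZMod 2 => (0 : ℕ))) (uStar id id)
        (fun s => φ (uAdd (· + ·) (· + ·) (fun _ : ZMod 2 => (0 : ℕ)) s (Sum.inl 1))) 1 := by
  intro φ hφ n s h
  refine negEigCount_le_one_of_nonneg_on_ker h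
    (∑ i, signChar (s i) • LinearMap.proj (R := ℂ) (φ := fun _ : Fin n => ℂ) i) fun x hx => ?_
  have hx' : ∑ i, signChar (s i) * x i = 0 := by simpa using hx
  refine (hφ n s x).trans_eq (Eq.symm ?_)
  rw [Finset.sum_comm]
  calc _ = ∑ j, ∑ i, (x i * starRingEnd ℂ (x j) *
          φ (uAdd (· + ·) (· + ·) (fun _ : ZMod 2 => (0 : ℕ)) (uStar id id (s j)) (s i)) -
        starRingEnd ℂ (x j) * (φ (Sum.inl 0) - φ (Sum.inl 1)) * signChar (s j) *
          (signChar (s i) * x i)) := by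
        simp only [dotProduct, Matrix.mulVec, Matrix.of_apply, Finset.mul_sum, translate_eq_sub,
          Pi.star_apply, RCLike.star_def]
        refine Finset.sum_congr rfl fun j _ => Finset.sum_congr rfl fun i _ => ?_
        ring
    _ = _ := by
        simp only [Finset.sum_sub_distrib, ← Finset.mul_sum, hx', mul_zero, sub_zero]
end
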